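/- Let d ∈ ℕ, ρ ≥ 1, C₀ > 0, A ≥ 1 and α ∈ (0,1). There exists an increasing function η : [1,∞) → [1,∞), independent of ρ (depending only on d, α, C₀), with the following property: if r̃ : ℝ^d → ℝ, b̃ : ℝ^d → ℝ^d and Σ̃ : ℝ^d → (symmetric d×d matrices) satisfy Σ̃(x) ≥ I_d/C₀ for all x and ‖r̃‖_{0,α} ≤ A, ‖b̃‖_{0,α} ≤ A, ‖Σ̃‖_{0,α} ≤ A, and if v ∈ C²(ℝ^d) is a bounded classical solution of ρ v(x) − r̃(x) − b̃(x)·Dv(x) − (1/2)tr(Σ̃(x) D²v(x)) = 0 on ℝ^d, then ρ‖v‖_∞ ≤ η(A), ρ^{1−α/2}[v]_{0,α} ≤ η(A), ρ^{1/2−α/2}[v]_{1,α} ≤ η(A), ρ^{−α/2}[v]_{2,α} ≤ η(A), ρ^{1/2}⟦v⟧₁ ≤ η(A), and ⟦v⟧₂ ≤ η(A). -/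

import Mathlib

open MeasureTheory Real Metric
noncomputable section

/-- First-order partial derivative `∂v/∂xᵢ`. -/
def pd1 (d : ℕ) (v : EuclideanSpace ℝ (Fin d) → ℝ) (x : EuclideanSpace ℝ (Fin d))
    (i : Fin d) : ℝ :=
  fderiv ℝ v x (EuclideanSpace.single i 1)

/-- Second-order partial derivative `∂²v/∂xᵢ∂xⱼ`. -/
def pd2 (d : ℕ) (v : EuclideanSpace ℝ (Fin d) → ℝ) (x : EuclideanSpace ℝ (Fin d))
    (i j : Fin d) : ℝ :=
  fderiv ℝ (fun y => fderiv ℝ v y (EuclideanSpace.single j 1)) x (EuclideanSpace.single i 1)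

/-- The forward difference of `u` with step `h`. -/
def shiftDiff {E : Type*} [AddCommGroup E] (h : E) (u : E → ℝ) (x : E) : ℝ :=
  u (x + h) - u x

lemma shiftDiff_comm {E : Type*} [AddCommGroup E] (h k : E) (u : E → ℝ) :
    shiftDiff h (shiftDiff k u) = shiftDiff k (shiftDiff h u) := by
  funext x
  simp only [shiftDiff, add_right_comm x h k]
  ring

section Calculus

variable {E : Type*} [NormedAddCommGroup E] [NormedSpace ℝ E]

/-- The second Fréchet derivative as a curried bilinear map. -/
def hess (u : E → ℝ) (x : E) : E →L[ℝ] E →L[ℝ] ℝ :=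
  fderiv ℝ (fderiv ℝ u) x

lemma hasFDerivAt_of_contDiff_two {u : E → ℝ} (hu : ContDiff ℝ 2 u) (x : E) :
    HasFDerivAt u (fderiv ℝ u x) x :=
  (hu.differentiable (by norm_num) x).hasFDerivAt

lemma hasFDerivAt_fderiv {u : E → ℝ} (hu : ContDiff ℝ 2 u) (x : E) :
    HasFDerivAt (fderiv ℝ u) (hess u x) x :=
  ((hu.fderiv_right (m := 1) (by norm_num)).differentiable (by norm_num) x).hasFDerivAt

lemma continuous_hess {u : E → ℝ} (hu : ContDiff ℝ 2 u) : Continuous (hess u) :=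
  (hu.fderiv_right (m := 1) (by norm_num)).continuous_fderiv (by norm_num)

lemma contDiff_shiftDiff {u : E → ℝ} (hu : ContDiff ℝ 2 u) (h : E) :
    ContDiff ℝ 2 (shiftDiff h u) := by
  unfold shiftDiff
  fun_prop

lemma hess_shiftDiff {u : E → ℝ} (hu : ContDiff ℝ 2 u) (h x : E) :
    hess (shiftDiff h u) x = hess u (x + h) - hess u x := by
  have h1 : fderiv ℝ (shiftDiff h u) = fun y => fderiv ℝ u (y + h) - fderiv ℝ u y := by
    funext y
    exact (((hasFDerivAt_comp_add_right h).2 (hasFDerivAt_of_contDiff_two hu (y + h))).sub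
      (hasFDerivAt_of_contDiff_two hu y)).fderiv
  have h2 : HasFDerivAt (fun y => fderiv ℝ u (y + h) - fderiv ℝ u y)
      (hess u (x + h) - hess u x) x :=
    ((hasFDerivAt_comp_add_right h).2 (hasFDerivAt_fderiv hu (x + h))).sub (hasFDerivAt_fderiv hu x)
  rw [hess, h1]
  exact h2.fderiv

/-- Mean value form of the mixed second difference. -/
lemma exists_shiftDiff_shiftDiff_eq {u : E → ℝ} (hu : ContDiff ℝ 2 u) (x h k : E) :
    ∃ a ∈ Set.Icc (0 : ℝ) 1, ∃ b ∈ Set.Icc (0 : ℝ) 1,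
      shiftDiff h (shiftDiff k u) x = hess u (x + a • h + b • k) k h := by
  have hf : ∀ a : ℝ, HasDerivAt (fun a : ℝ => shiftDiff k u (x + a • h))
      (fderiv ℝ u (x + a • h + k) h - fderiv ℝ u (x + a • h) h) a := by
    intro a
    have hl : HasDerivAt (fun a : ℝ => x + a • h) h a := by
      simpa using ((hasDerivAt_id a).smul_const h).const_add x
    have h1 := (hasFDerivAt_of_contDiff_two hu (x + a • h)).comp_hasDerivAt a hl
    have h2 := (hasFDerivAt_of_contDiff_two hu (x + a • h + k)).comp_hasDerivAt a
      (hl.add_const k)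
    exact h2.sub h1
  obtain ⟨a, ha, hae⟩ := exists_hasDerivAt_eq_slope _ _ zero_lt_one
    (fun a _ => (hf a).continuousAt.continuousWithinAt) (fun a _ => hf a)
  have hg : ∀ b : ℝ, HasDerivAt (fun b : ℝ => fderiv ℝ u (x + a • h + b • k) h)
      (hess u (x + a • h + b • k) k h) b := by
    intro b
    have hl : HasDerivAt (fun b : ℝ => x + a • h + b • k) k b := by
      simpa using ((hasDerivAt_id b).smul_const k).const_add (x + a • h)
    have h1 := (hasFDerivAt_fderiv hu (x + a • h + b • k)).comp_hasDerivAt b hl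
    simpa using h1.clm_apply (hasDerivAt_const b h)
  obtain ⟨b, hb, hbe⟩ := exists_hasDerivAt_eq_slope _ _ zero_lt_one
    (fun b _ => (hg b).continuousAt.continuousWithinAt) (fun b _ => hg b)
  refine ⟨a, ⟨ha.1.le, ha.2.le⟩, b, ⟨hb.1.le, hb.2.le⟩, ?_⟩
  simp only [one_smul, zero_smul, add_zero, sub_zero, div_one] at hae hbe
  rw [hbe, hae]
  rfl

/-- Convergence of mixed second difference quotients, with a base point depending on the step. -/
lemma tendsto_shiftDiff_div_sq {u : E → ℝ} (hu : ContDiff ℝ 2 u) (x c h k : E) :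
    Filter.Tendsto
      (fun s : ℝ => shiftDiff (s • h) (shiftDiff (s • k) u) (x + s • c) / s ^ 2)
      (nhdsWithin 0 (Set.Ioi 0)) (nhds (hess u x k h)) := by
  choose a ha b hb hab using fun s : ℝ =>
    exists_shiftDiff_shiftDiff_eq hu (x + s • c) (s • h) (s • k)
  have hpt : Filter.Tendsto (fun s : ℝ => x + s • c + a s • s • h + b s • s • k)
      (nhdsWithin 0 (Set.Ioi 0)) (nhds x) := by
    have hs : Filter.Tendsto (fun s : ℝ => s) (nhdsWithin 0 (Set.Ioi 0)) (nhds 0) :=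
      tendsto_nhdsWithin_of_tendsto_nhds Filter.tendsto_id
    have key : ∀ (t : ℝ → ℝ) (w : E), (∀ s, t s ∈ Set.Icc (0 : ℝ) 1) →
        Filter.Tendsto (fun s : ℝ => t s • s • w) (nhdsWithin 0 (Set.Ioi 0)) (nhds 0) := by
      intro t w ht
      have : Filter.Tendsto (fun s : ℝ => ‖s • w‖) (nhdsWithin 0 (Set.Ioi 0)) (nhds 0) := by
        simpa using (hs.smul_const w).norm
      refine squeeze_zero_norm (fun s => ?_) this
      rw [norm_smul, Real.norm_of_nonneg (ht s).1]
      exact mul_le_of_le_one_left (norm_nonneg _) (ht s).2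
    have h0 : Filter.Tendsto (fun s : ℝ => s • c) (nhdsWithin 0 (Set.Ioi 0)) (nhds 0) := by
      simpa using hs.smul_const c
    simpa using ((tendsto_const_nhds (x := x)).add h0).add (key a h ha) |>.add (key b k hb)
  have hc : Filter.Tendsto (fun s : ℝ => hess u (x + s • c + a s • s • h + b s • s • k) k h)
      (nhdsWithin 0 (Set.Ioi 0)) (nhds (hess u x k h)) := by
    have : Continuous fun y => hess u y k h := by
      have := continuous_hess hu
      fun_prop
    exact (this.tendsto x).comp hpt
  refine hc.congr' ?_
  filter_upwards [self_mem_nhdsWithin] with s hs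
  have hs' : s ≠ 0 := ne_of_gt hs
  rw [hab s]
  simp only [map_smul, smul_eq_mul, smul_apply]
  field_simp

/-- Convergence of symmetric second difference quotients. -/
lemma tendsto_symm_diff_div_sq {u : E → ℝ} (hu : ContDiff ℝ 2 u) (x c : E) :
    Filter.Tendsto (fun s : ℝ => (u (x + s • c) + u (x - s • c) - 2 * u x) / s ^ 2)
      (nhdsWithin 0 (Set.Ioi 0)) (nhds (hess u x c c)) := by
  refine (tendsto_shiftDiff_div_sq hu x (-c) c c).congr fun s => ?_
  simp only [shiftDiff, smul_neg, neg_add_cancel_right, sub_eq_add_neg]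
  ring_nf

end Calculus

section Elliptic

variable {E : Type*} [NormedAddCommGroup E] [InnerProductSpace ℝ E]

/-- A linear functional on bilinear maps which, for every unit vector `e`, is `κ` times the
evaluation at `(e, e)` plus a sum of squares, with total trace at most `τ`. -/
def IsEllipticForm (κ τ : ℝ) (ℓ : (E →L[ℝ] E →L[ℝ] ℝ) →ₗ[ℝ] ℝ) : Prop :=
  ∀ e : E, ‖e‖ = 1 → ∃ (n : ℕ) (c : Fin n → E), κ + ∑ k, ‖c k‖ ^ 2 ≤ τ ∧
    ∀ Q : E →L[ℝ] E →L[ℝ] ℝ, ℓ Q = κ * Q e e + ∑ k, Q (c k) (c k)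

variable {κ τ : ℝ} {ℓ : (E →L[ℝ] E →L[ℝ] ℝ) →ₗ[ℝ] ℝ}

lemma norm_add_smul_sq_add_norm_sub_smul_sq (x a : E) (s : ℝ) :
    ‖x + s • a‖ ^ 2 + ‖x - s • a‖ ^ 2 = 2 * ‖x‖ ^ 2 + 2 * s ^ 2 * ‖a‖ ^ 2 := by
  have h := parallelogram_law_with_norm ℝ x (s • a)
  have h2 : ‖s • a‖ ^ 2 = s ^ 2 * ‖a‖ ^ 2 := by rw [norm_smul, mul_pow, norm_eq_abs, sq_abs]
  nlinarith [h, h2]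

/-- Doubling of variables: the antisymmetrised function `u (x + t e) - u (x - t e)` is compared
with a quadratic barrier on a half ball. -/
lemma sub_le_barrier [FiniteDimensional ℝ E] {u : E → ℝ} (hu : ContDiff ℝ 2 u)
    (hκ : 0 ≤ κ) (hℓ : IsEllipticForm κ τ ℓ) {x₀ e : E} {R m ε q : ℝ} (hR : 0 < R) (hm : 0 ≤ m)
    (hosc : ∀ y ∈ closedBall x₀ R, ∀ z ∈ closedBall x₀ R, u y - u z ≤ m)
    (hε : ∀ y ∈ closedBall x₀ R, |ℓ (hess u y)| ≤ ε) (he : ‖e‖ = 1)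
    (hq0 : 0 ≤ q) (hq : 4 * m * τ / R ^ 2 + ε < q * κ) {t : ℝ} (ht : t ∈ Set.Icc 0 (R / 2)) :
    u (x₀ + t • e) - u (x₀ - t • e) ≤ 4 * m / R ^ 2 * t ^ 2 + q * (t * (R - t)) := by
  set β : ℝ := 4 * m / R ^ 2 with hβ
  have hβ0 : 0 ≤ β := by positivity
  let K : Set (E × ℝ) := {p | ‖p.1‖ ^ 2 + p.2 ^ 2 ≤ R ^ 2 / 4 ∧ 0 ≤ p.2}
  let G : E × ℝ → ℝ := fun p => u (x₀ + p.1 + p.2 • e) - u (x₀ + p.1 - p.2 • e)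
    - β * (‖p.1‖ ^ 2 + p.2 ^ 2) - q * (p.2 * (R - p.2))
  have hGc : Continuous G := by
    have := hu.continuous
    fun_prop
  have hKb : ∀ p ∈ K, ‖p.1‖ ≤ R / 2 ∧ p.2 ≤ R / 2 := by
    rintro p ⟨h1, h2⟩
    constructor
    · exact abs_le_of_sq_le_sq' (by nlinarith [sq_nonneg p.2]) (by positivity) |>.2
    · exact abs_le_of_sq_le_sq' (by nlinarith [sq_nonneg ‖p.1‖]) (by positivity) |>.2
  have hKc : IsCompact K := by
    have hcl : IsClosed K := by
      have h1 : IsClosed {p : E × ℝ | ‖p.1‖ ^ 2 + p.2 ^ 2 ≤ R ^ 2 / 4} :=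
        isClosed_le (by fun_prop) (by fun_prop)
      have h2 : IsClosed {p : E × ℝ | 0 ≤ p.2} := isClosed_le (by fun_prop) (by fun_prop)
      exact h1.inter h2
    refine IsCompact.of_isClosed_subset
      ((isCompact_closedBall (0 : E) (R / 2)).prod (isCompact_Icc (a := (0 : ℝ)) (b := R / 2)))
      hcl ?_
    intro p hp
    exact ⟨by simpa using (hKb p hp).1, hp.2, (hKb p hp).2⟩
  have hball : ∀ p ∈ K, x₀ + p.1 + p.2 • e ∈ closedBall x₀ R ∧
      x₀ + p.1 - p.2 • e ∈ closedBall x₀ R := by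
    intro p hp
    have h1 := hKb p hp
    have h2 : ‖p.2 • e‖ ≤ R / 2 := by
      rw [norm_smul, he, mul_one, norm_of_nonneg hp.2]; exact h1.2
    constructor
    · rw [mem_closedBall_iff_norm, add_assoc, add_sub_cancel_left]
      exact (norm_add_le _ _).trans (by linarith)
    · rw [mem_closedBall_iff_norm, add_sub_assoc, add_sub_cancel_left]
      exact (norm_sub_le _ _).trans (by linarith)
  have htK : ((0 : E), t) ∈ K := by
    refine ⟨?_, ht.1⟩
    simp only [norm_zero]
    nlinarith [ht.1, ht.2]
  obtain ⟨p, hpK, hpmax⟩ := hKc.exists_isMaxOn ⟨_, htK⟩ hGc.continuousOn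
  have hfin : G p ≤ 0 := by
    by_contra! hpos
    have hp2 : 0 < p.2 := by
      rcases hpK.2.lt_or_eq with h | h
      · exact h
      · exfalso
        simp only [G, ← h, zero_smul, add_zero, sub_zero, sub_self, zero_mul, mul_zero] at hpos
        have : 0 ≤ β * (‖p.1‖ ^ 2 + 0 ^ 2) := by positivity
        linarith
    have hq1 : 0 ≤ q * (p.2 * (R - p.2)) :=
      mul_nonneg hq0 (mul_nonneg hp2.le (by linarith [(hKb p hpK).2]))
    have hp1 : ‖p.1‖ ^ 2 + p.2 ^ 2 < R ^ 2 / 4 := by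
      rcases hpK.1.lt_or_eq with h | h
      · exact h
      · exfalso
        have h1 := hosc _ (hball p hpK).1 _ (hball p hpK).2
        have h2 : β * (‖p.1‖ ^ 2 + p.2 ^ 2) = m := by
          rw [h, hβ]; field_simp
        simp only [G] at hpos
        linarith
    have hdir : ∀ (a : E) (b : ℝ),
        hess u (x₀ + p.1 + p.2 • e) (a + b • e) (a + b • e)
          - hess u (x₀ + p.1 - p.2 • e) (a - b • e) (a - b • e)
          ≤ 2 * β * (‖a‖ ^ 2 + b ^ 2) - 2 * q * b ^ 2 := by
      intro a b
      have h1 := (tendsto_symm_diff_div_sq hu (x₀ + p.1 + p.2 • e) (a + b • e)).sub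
        (tendsto_symm_diff_div_sq hu (x₀ + p.1 - p.2 • e) (a - b • e))
      refine le_of_tendsto h1 ?_
      have hU : IsOpen {r : E × ℝ | ‖r.1‖ ^ 2 + r.2 ^ 2 < R ^ 2 / 4 ∧ 0 < r.2} := by
        have h1 : IsOpen {r : E × ℝ | ‖r.1‖ ^ 2 + r.2 ^ 2 < R ^ 2 / 4} :=
          isOpen_lt (by fun_prop) (by fun_prop)
        have h2 : IsOpen {r : E × ℝ | 0 < r.2} := isOpen_lt (by fun_prop) (by fun_prop)
        exact h1.inter h2
      have hev : ∀ b' : ℝ, ∀ a' : E, ∀ᶠ s : ℝ in nhdsWithin 0 (Set.Ioi 0),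
          (p.1 + s • a', p.2 + s * b') ∈
            {r : E × ℝ | ‖r.1‖ ^ 2 + r.2 ^ 2 < R ^ 2 / 4 ∧ 0 < r.2} := by
        intro b' a'
        apply nhdsWithin_le_nhds
        have hc : Continuous fun s : ℝ => (p.1 + s • a', p.2 + s * b') := by fun_prop
        refine hc.continuousAt.eventually_mem (hU.mem_nhds ?_)
        simpa using ⟨hp1, hp2⟩
      filter_upwards [hev b a, hev (-b) (-a), self_mem_nhdsWithin] with s hs1 hs2 hs0
      have hs0' : (0 : ℝ) < s := hs0
      have g1 : G (p.1 + s • a, p.2 + s * b) ≤ G p := hpmax ⟨hs1.1.le, hs1.2.le⟩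
      have g2 : G (p.1 + s • -a, p.2 + s * -b) ≤ G p := hpmax ⟨hs2.1.le, hs2.2.le⟩
      have hn := norm_add_smul_sq_add_norm_sub_smul_sq p.1 a s
      simp only [G] at g1 g2
      have e1 : x₀ + (p.1 + s • a) + (p.2 + s * b) • e
          = x₀ + p.1 + p.2 • e + s • (a + b • e) := by module
      have e2 : x₀ + (p.1 + s • a) - (p.2 + s * b) • e
          = x₀ + p.1 - p.2 • e + s • (a - b • e) := by module
      have e3 : x₀ + (p.1 + s • -a) + (p.2 + s * -b) • e
          = x₀ + p.1 + p.2 • e - s • (a + b • e) := by module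
      have e4 : x₀ + (p.1 + s • -a) - (p.2 + s * -b) • e
          = x₀ + p.1 - p.2 • e - s • (a - b • e) := by module
      have e5 : p.1 + s • -a = p.1 - s • a := by module
      rw [e1, e2] at g1
      rw [e3, e4, e5] at g2
      rw [← sub_div, div_le_iff₀ (by positivity)]
      have h3 : β * (‖p.1 + s • a‖ ^ 2) + β * (‖p.1 - s • a‖ ^ 2)
          = β * (2 * ‖p.1‖ ^ 2 + 2 * s ^ 2 * ‖a‖ ^ 2) := by rw [← hn]; ring
      nlinarith [g1, g2, h3]
    obtain ⟨n, c, hc, hQ⟩ := hℓ e he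
    have hup : ℓ (hess u (x₀ + p.1 + p.2 • e)) - ℓ (hess u (x₀ + p.1 - p.2 • e))
        = κ * (hess u (x₀ + p.1 + p.2 • e) e e - hess u (x₀ + p.1 - p.2 • e) e e)
          + ∑ k, (hess u (x₀ + p.1 + p.2 • e) (c k) (c k)
            - hess u (x₀ + p.1 - p.2 • e) (c k) (c k)) := by
      rw [hQ, hQ, Finset.sum_sub_distrib]; ring
    have hsum : ∑ k, (hess u (x₀ + p.1 + p.2 • e) (c k) (c k)
            - hess u (x₀ + p.1 - p.2 • e) (c k) (c k)) ≤ 2 * β * ∑ k, ‖c k‖ ^ 2 := by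
      rw [Finset.mul_sum]
      refine Finset.sum_le_sum fun k _ => ?_
      simpa using hdir (c k) 0
    have hee := hdir 0 1
    simp only [one_smul, zero_add, zero_sub, norm_zero, map_neg, neg_apply, neg_neg] at hee
    have l1 := (abs_le.1 (hε _ (hball p hpK).1)).1
    have l2 := (abs_le.1 (hε _ (hball p hpK).2)).2
    have h1 := mul_le_mul_of_nonneg_left hee hκ
    have h2 := mul_le_mul_of_nonneg_left hc hβ0
    have h3 : β * τ + ε < q * κ := by
      convert hq using 2
      rw [hβ]; ring
    nlinarith [h1, h2, h3]
  have := (hpmax htK).trans hfin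
  simp only [G, norm_zero, add_zero] at this
  nlinarith

/-- Interior Lipschitz estimate for a constant-coefficient elliptic operator, in terms of the
oscillation of the solution and the size of the right-hand side. -/
lemma abs_sub_le_of_osc [FiniteDimensional ℝ E] {u : E → ℝ} (hu : ContDiff ℝ 2 u)
    (hκ : 0 < κ) (hτ : 0 ≤ τ) (hℓ : IsEllipticForm κ τ ℓ) {x₀ : E} {R m ε : ℝ} (hR : 0 < R)
    (hosc : ∀ y ∈ closedBall x₀ (2 * R), ∀ z ∈ closedBall x₀ (2 * R), u y - u z ≤ m)
    (hε : ∀ y ∈ closedBall x₀ (2 * R), |ℓ (hess u y)| ≤ ε)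
    {y z : E} (hy : y ∈ closedBall x₀ R) (hz : z ∈ closedBall x₀ R) :
    |u y - u z| ≤ (1 + (2 * τ + 1) / κ) * (‖y - z‖ / R) * (m + R ^ 2 * ε) := by
  have hx₀ : x₀ ∈ closedBall x₀ (2 * R) := mem_closedBall_self (by positivity)
  have hm : 0 ≤ m := by simpa using hosc x₀ hx₀ x₀ hx₀
  have hε0 : 0 ≤ ε := (abs_nonneg _).trans (hε x₀ hx₀)
  have hsub : closedBall x₀ R ⊆ closedBall x₀ (2 * R) := closedBall_subset_closedBall (by linarith)
  have key : ∀ y ∈ closedBall x₀ R, ∀ z ∈ closedBall x₀ R,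
      u y - u z ≤ (1 + (2 * τ + 1) / κ) * (‖y - z‖ / R) * (m + R ^ 2 * ε) := by
    intro y hy z hz
    rcases eq_or_ne y z with rfl | hyz
    · simp
    have hn : 0 < ‖y - z‖ := norm_pos_iff.2 (sub_ne_zero.2 hyz)
    rcases le_total R ‖y - z‖ with hlarge | hsmall
    · have h1 : 1 ≤ ‖y - z‖ / R := (one_le_div hR).2 hlarge
      have h2 : 0 ≤ (2 * τ + 1) / κ := by positivity
      have h3 : 1 ≤ (1 + (2 * τ + 1) / κ) * (‖y - z‖ / R) := by nlinarith
      calc u y - u z ≤ m := hosc y (hsub hy) z (hsub hz)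
        _ ≤ m + R ^ 2 * ε := by nlinarith [mul_nonneg (sq_nonneg R) hε0]
        _ ≤ _ := le_mul_of_one_le_left (by positivity) h3
    set t : ℝ := ‖y - z‖ / 2 with ht
    set e : E := (‖y - z‖)⁻¹ • (y - z) with he
    set w : E := (1 / 2 : ℝ) • (y + z) with hw
    have he1 : ‖e‖ = 1 := by
      rw [he, norm_smul, norm_inv, norm_norm, inv_mul_cancel₀ hn.ne']
    have hte : t • e = (1 / 2 : ℝ) • (y - z) := by
      rw [ht, he, smul_smul]; congr 1; field_simp
    have hwy : w + t • e = y := by rw [hte, hw]; module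
    have hwz : w - t • e = z := by rw [hte, hw]; module
    have hwb : w ∈ closedBall x₀ R := by
      have := (convex_closedBall x₀ R) hy hz (by norm_num : (0 : ℝ) ≤ 1 / 2)
        (by norm_num : (0 : ℝ) ≤ 1 / 2) (by norm_num)
      rwa [← smul_add] at this
    have hws : closedBall w R ⊆ closedBall x₀ (2 * R) := by
      apply closedBall_subset_closedBall'
      have := mem_closedBall.1 hwb
      linarith
    refine le_of_forall_pos_le_add fun δ hδ => ?_
    have htR : t * R > 0 := by positivity
    have hb := sub_le_barrier (q := (4 * m * τ / R ^ 2 + ε) / κ + δ / (t * R)) hu hκ.le hℓ hR hm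
      (fun y hy z hz => hosc y (hws hy) z (hws hz)) (fun y hy => hε y (hws hy)) he1
      (by positivity) (by
        rw [add_mul, div_mul_cancel₀ _ hκ.ne']
        have : 0 < δ / (t * R) * κ := by positivity
        linarith) (t := t) ⟨by positivity, by rw [ht]; linarith⟩
    rw [hwy, hwz] at hb
    have htR2 : t ≤ R / 2 := by rw [ht]; linarith
    have ht0 : 0 < t := by positivity
    have h1 : 4 * m / R ^ 2 * t ^ 2 ≤ 2 * t / R * m := by
      rw [div_mul_eq_mul_div, div_mul_eq_mul_div, div_le_div_iff₀ (by positivity) hR]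
      have := mul_nonneg (mul_nonneg (mul_nonneg hm ht0.le) hR.le) (sub_nonneg.2 htR2)
      nlinarith
    have h2 : ((4 * m * τ / R ^ 2 + ε) / κ + δ / (t * R)) * (t * (R - t))
        ≤ ((4 * m * τ / R ^ 2 + ε) / κ + δ / (t * R)) * (t * R) :=
      mul_le_mul_of_nonneg_left (by nlinarith) (by positivity)
    have h3 : ((4 * m * τ / R ^ 2 + ε) / κ + δ / (t * R)) * (t * R)
        = 2 * t / R * ((2 * m * τ + R ^ 2 * ε / 2) / κ) + δ := by
      field_simp; ring
    have h4 : ‖y - z‖ / R = 2 * t / R := by rw [ht]; ring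
    have h5 : m + (2 * m * τ + R ^ 2 * ε / 2) / κ
        ≤ (1 + (2 * τ + 1) / κ) * (m + R ^ 2 * ε) := by
      have e1 : (1 + (2 * τ + 1) / κ) * (m + R ^ 2 * ε)
          - (m + (2 * m * τ + R ^ 2 * ε / 2) / κ)
          = R ^ 2 * ε + (m + 2 * τ * (R ^ 2 * ε) + R ^ 2 * ε / 2) / κ := by
        field_simp; ring
      have e2 : 0 ≤ R ^ 2 * ε + (m + 2 * τ * (R ^ 2 * ε) + R ^ 2 * ε / 2) / κ := by positivity
      linarith
    have h6 := mul_le_mul_of_nonneg_left h5 (by positivity : 0 ≤ 2 * t / R)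
    rw [h4]
    nlinarith
  rw [abs_sub_le_iff]
  exact ⟨key y hy z hz, by rw [norm_sub_rev]; exact key z hz y hy⟩

end Elliptic

section Decay

variable {E : Type*} [NormedAddCommGroup E]

/-- The mixed second differences of `u` with steps bounded by `a` and `b` oscillate by at most `m`
on the ball of radius `ρ` around `x₀`. -/
def OscBound (u : E → ℝ) (x₀ : E) (a b ρ m : ℝ) : Prop :=
  ∀ h k : E, ‖h‖ ≤ a → ‖k‖ ≤ b → ∀ y ∈ closedBall x₀ ρ, ∀ z ∈ closedBall x₀ ρ,
    shiftDiff h (shiftDiff k u) y - shiftDiff h (shiftDiff k u) z ≤ m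

lemma OscBound.mono {u : E → ℝ} {x₀ : E} {a b ρ m a' b' ρ' m' : ℝ} (h : OscBound u x₀ a b ρ m)
    (ha : a' ≤ a) (hb : b' ≤ b) (hρ : ρ' ≤ ρ) (hm : m ≤ m') : OscBound u x₀ a' b' ρ' m' :=
  fun p k hp hk y hy z hz =>
    (h p k (hp.trans ha) (hk.trans hb) y (closedBall_subset_closedBall hρ hy) z
      (closedBall_subset_closedBall hρ hz)).trans hm

lemma OscBound.symm {u : E → ℝ} {x₀ : E} {a b ρ m : ℝ} (h : OscBound u x₀ a b ρ m) :
    OscBound u x₀ b a ρ m := by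
  intro p k hp hk y hy z hz
  rw [shiftDiff_comm]
  exact h k p hk hp y hy z hz

lemma OscBound.abs_le {u : E → ℝ} {x₀ : E} {a b ρ m : ℝ} (hosc : OscBound u x₀ a b ρ m) {h k : E}
    (hh : ‖h‖ ≤ a) (hk : ‖k‖ ≤ b) {y z : E} (hy : y ∈ closedBall x₀ ρ) (hz : z ∈ closedBall x₀ ρ) :
    |shiftDiff h (shiftDiff k u) y - shiftDiff h (shiftDiff k u) z| ≤ m :=
  abs_sub_le_iff.2 ⟨hosc h k hh hk y hy z hz, hosc h k hh hk z hz y hy⟩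

variable [InnerProductSpace ℝ E]

lemma abs_apply_hess_shiftDiff_le {u : E → ℝ} (hu : ContDiff ℝ 2 u)
    {ℓ : (E →L[ℝ] E →L[ℝ] ℝ) →ₗ[ℝ] ℝ} {x₀ : E} {a b ρ c ε : ℝ}
    (hε : ∀ y ∈ closedBall x₀ (ρ + a + b), |ℓ (hess u y) - c| ≤ ε) {h k : E} (hh : ‖h‖ ≤ a)
    (hk : ‖k‖ ≤ b) {y : E} (hy : y ∈ closedBall x₀ ρ) :
    |ℓ (hess (shiftDiff h (shiftDiff k u)) y)| ≤ 4 * ε := by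
  have hmem : ∀ w : E, ‖w‖ ≤ a + b → y + w ∈ closedBall x₀ (ρ + a + b) := by
    intro w hw
    rw [mem_closedBall_iff_norm] at hy ⊢
    calc ‖y + w - x₀‖ = ‖(y - x₀) + w‖ := by congr 1; abel
      _ ≤ ‖y - x₀‖ + ‖w‖ := norm_add_le _ _
      _ ≤ ρ + a + b := by linarith
  have hh0 := norm_nonneg h
  have hk0 := norm_nonneg k
  have hmap : ℓ (hess (shiftDiff h (shiftDiff k u)) y)
      = ℓ (hess u (y + h + k)) - ℓ (hess u (y + h)) - (ℓ (hess u (y + k)) - ℓ (hess u y)) := by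
    rw [hess_shiftDiff (contDiff_shiftDiff hu k), hess_shiftDiff hu, hess_shiftDiff hu]
    have hs : ∀ P Q : E →L[ℝ] E →L[ℝ] ℝ, ℓ (P - Q) = ℓ P - ℓ Q := fun P Q => ℓ.map_sub P Q
    rw [hs, hs, hs]
  rw [hmap]
  have h1 := abs_le.1 (hε _ (hmem 0 (by simp; linarith)))
  have h2 := abs_le.1 (hε _ (hmem h (by linarith)))
  have h3 := abs_le.1 (hε _ (hmem k (by linarith)))
  have h4 := abs_le.1 (hε _ (hmem (h + k) ((norm_add_le _ _).trans (by linarith))))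
  rw [add_zero] at h1
  rw [← add_assoc] at h4
  rw [abs_le]
  constructor <;> linarith [h1.1, h1.2, h2.1, h2.2, h3.1, h3.2, h4.1, h4.2]

variable [FiniteDimensional ℝ E] {κ τ : ℝ} {ℓ : (E →L[ℝ] E →L[ℝ] ℝ) →ₗ[ℝ] ℝ}

lemma OscBound.lipschitz {u : E → ℝ} (hu : ContDiff ℝ 2 u) (hκ : 0 < κ) (hτ : 0 ≤ τ)
    (hℓ : IsEllipticForm κ τ ℓ) {x₀ : E} {a b R m c ε : ℝ} (hR : 0 < R)
    (hosc : OscBound u x₀ a b (2 * R) m)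
    (hε : ∀ y ∈ closedBall x₀ (2 * R + a + b), |ℓ (hess u y) - c| ≤ ε) {h k : E} (hh : ‖h‖ ≤ a)
    (hk : ‖k‖ ≤ b) {y z : E} (hy : y ∈ closedBall x₀ R) (hz : z ∈ closedBall x₀ R) :
    |shiftDiff h (shiftDiff k u) y - shiftDiff h (shiftDiff k u) z|
      ≤ (1 + (2 * τ + 1) / κ) * (‖y - z‖ / R) * (m + R ^ 2 * (4 * ε)) :=
  abs_sub_le_of_osc (contDiff_shiftDiff (contDiff_shiftDiff hu k) h) hκ hτ hℓ hR
    (hosc h k hh hk) (fun _ hy => abs_apply_hess_shiftDiff_le hu hε hh hk hy) hy hz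

/-- Exchanging a difference step with the displacement gains a factor `μ / R`. -/
lemma OscBound.exchange {u : E → ℝ} (hu : ContDiff ℝ 2 u) (hκ : 0 < κ) (hτ : 0 ≤ τ)
    (hℓ : IsEllipticForm κ τ ℓ) {x₀ : E} {a b R m c ε μ ρ : ℝ} (hR : 0 < R) (hm : 0 ≤ m)
    (hε0 : 0 ≤ ε) (hosc : OscBound u x₀ a b (2 * R) m)
    (hε : ∀ y ∈ closedBall x₀ (2 * R + a + b), |ℓ (hess u y) - c| ≤ ε)
    (hρb : 2 * ρ ≤ b) (hρR : ρ + μ ≤ R) (hμ : 0 ≤ μ) :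
    OscBound u x₀ a μ ρ ((1 + (2 * τ + 1) / κ) * (μ / R) * (m + R ^ 2 * (4 * ε))) := by
  intro h l hh hl y hy z hz
  have hk : ‖y - z‖ ≤ b := by
    rw [mem_closedBall_iff_norm] at hy hz
    calc ‖y - z‖ = ‖(y - x₀) - (z - x₀)‖ := by congr 1; abel
      _ ≤ ‖y - x₀‖ + ‖z - x₀‖ := norm_sub_le _ _
      _ ≤ b := by linarith
  have hz' : z ∈ closedBall x₀ R := closedBall_subset_closedBall (by linarith) hz
  have hzl : z + l ∈ closedBall x₀ R := by
    rw [mem_closedBall_iff_norm] at hz ⊢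
    calc ‖z + l - x₀‖ = ‖(z - x₀) + l‖ := by congr 1; abel
      _ ≤ ‖z - x₀‖ + ‖l‖ := norm_add_le _ _
      _ ≤ R := by linarith
  have h1 := OscBound.lipschitz hu hκ hτ hℓ hR hosc hε hh hk hzl hz'
  have h2 : shiftDiff h (shiftDiff l u) y - shiftDiff h (shiftDiff l u) z
      = shiftDiff h (shiftDiff (y - z) u) (z + l) - shiftDiff h (shiftDiff (y - z) u) z := by
    have e1 : z + h + l + (y - z) = y + h + l := by abel
    have e2 : z + l + (y - z) = y + l := by abel
    have e3 : z + h + (y - z) = y + h := by abel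
    have e4 : z + (y - z) = y := by abel
    have e5 : z + l + h = z + h + l := by abel
    simp only [shiftDiff, e1, e2, e3, e4, e5]
    ring
  rw [h2]
  refine (le_abs_self _).trans (h1.trans ?_)
  rw [add_sub_cancel_left]
  gcongr

/-- Three applications of the Lipschitz estimate shrink the third differences by the cube of the
scaling factor. -/
lemma OscBound.scale {u : E → ℝ} (hu : ContDiff ℝ 2 u) (hκ : 0 < κ) (hτ : 0 ≤ τ)
    (hℓ : IsEllipticForm κ τ ℓ) {x₀ : E} {r T c ε l X : ℝ} (hr : 0 < r) (hT : 0 ≤ T)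
    (hε0 : 0 ≤ ε) (hosc : OscBound u x₀ r r r T)
    (hε : ∀ y ∈ closedBall x₀ (4 * r), |ℓ (hess u y) - c| ≤ ε)
    (hl0 : 0 < l) (hl : l ≤ 1 / 32) (hX : X = 64 * (1 + (2 * τ + 1) / κ) * l) (hX1 : X ≤ 1) :
    OscBound u x₀ (l * r) (l * r) (l * r) (X ^ 3 * T + 3 * (r ^ 2 * ε)) := by
  set Λ : ℝ := 1 + (2 * τ + 1) / κ with hΛ
  have hΛ0 : 0 < Λ := by positivity
  have hX0 : 0 ≤ X := by rw [hX]; positivity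
  have hlr : l * r ≤ r / 32 := by nlinarith
  have hlr0 : 0 < l * r := by positivity
  have hball : ∀ {s : ℝ}, s ≤ 4 * r → ∀ y ∈ closedBall x₀ s, |ℓ (hess u y) - c| ≤ ε :=
    fun hs y hy => hε y (closedBall_subset_closedBall hs hy)
  have o1 : OscBound u x₀ r (l * r) (r / 4) (X * (T + r ^ 2 * ε)) := by
    refine (OscBound.exchange (R := r / 2) hu hκ hτ hℓ (by positivity) hT hε0
      (hosc.mono le_rfl le_rfl (by linarith) le_rfl) (hball (by linarith))
      (μ := l * r) (ρ := r / 4) (by linarith) (by linarith) hlr0.le).mono le_rfl le_rfl le_rfl ?_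
    rw [← hΛ]
    have e1 : Λ * (l * r / (r / 2)) * (T + (r / 2) ^ 2 * (4 * ε))
        = 2 * Λ * l * (T + r ^ 2 * ε) := by field_simp; ring
    rw [e1, hX]
    have : 0 ≤ Λ * l * (T + r ^ 2 * ε) := by positivity
    linarith
  have o2 : OscBound u x₀ (l * r) (l * r) (r / 16)
      (X * (X * (T + r ^ 2 * ε) + r ^ 2 * ε)) := by
    refine (OscBound.exchange (R := r / 8) hu hκ hτ hℓ (by positivity) (by positivity) hε0
      (o1.symm.mono le_rfl le_rfl (by linarith) le_rfl) (hball (by linarith))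
      (μ := l * r) (ρ := r / 16) (by linarith) (by linarith) hlr0.le).mono le_rfl le_rfl le_rfl ?_
    rw [← hΛ]
    have e1 : Λ * (l * r / (r / 8)) * (X * (T + r ^ 2 * ε) + (r / 8) ^ 2 * (4 * ε))
        = 8 * Λ * l * (X * (T + r ^ 2 * ε) + r ^ 2 * ε / 16) := by field_simp; ring
    rw [e1]
    calc 8 * Λ * l * (X * (T + r ^ 2 * ε) + r ^ 2 * ε / 16)
        ≤ 64 * Λ * l * (X * (T + r ^ 2 * ε) + r ^ 2 * ε) := by
          gcongr
          · norm_num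
          · have : 0 ≤ r ^ 2 * ε := by positivity
            linarith
      _ = _ := by rw [hX]
  intro h k hh hk y hy z hz
  have hsub : closedBall x₀ (l * r) ⊆ closedBall x₀ (r / 32) :=
    closedBall_subset_closedBall hlr
  have h1 := OscBound.lipschitz (R := r / 32) hu hκ hτ hℓ (by positivity)
    (o2.mono le_rfl le_rfl (by linarith) le_rfl) (hball (by linarith)) hh hk (hsub hy) (hsub hz)
  refine (le_abs_self _).trans (h1.trans ?_)
  have hyz : ‖y - z‖ ≤ 2 * (l * r) := by
    rw [mem_closedBall_iff_norm] at hy hz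
    calc ‖y - z‖ = ‖(y - x₀) - (z - x₀)‖ := by congr 1; abel
      _ ≤ ‖y - x₀‖ + ‖z - x₀‖ := norm_sub_le _ _
      _ ≤ _ := by linarith
  rw [← hΛ]
  have hre : 0 ≤ r ^ 2 * ε := by positivity
  calc Λ * (‖y - z‖ / (r / 32)) * (X * (X * (T + r ^ 2 * ε) + r ^ 2 * ε)
        + (r / 32) ^ 2 * (4 * ε))
      ≤ Λ * (2 * (l * r) / (r / 32)) * (X * (X * (T + r ^ 2 * ε) + r ^ 2 * ε) + r ^ 2 * ε) := by
        have : (r / 32) ^ 2 * (4 * ε) ≤ r ^ 2 * ε := by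
          have : (r / 32) ^ 2 * (4 * ε) = r ^ 2 * ε / 256 := by ring
          linarith
        gcongr
    _ = X * (X * (X * (T + r ^ 2 * ε) + r ^ 2 * ε) + r ^ 2 * ε) := by
        have : Λ * (2 * (l * r) / (r / 32)) = X := by rw [hX]; field_simp; ring
        rw [this]
    _ = X ^ 3 * T + (X ^ 3 + X ^ 2 + X) * (r ^ 2 * ε) := by ring
    _ ≤ _ := by
        have h2 : X ^ 2 ≤ 1 := pow_le_one₀ hX0 hX1
        have h3 : X ^ 3 ≤ 1 := pow_le_one₀ hX0 hX1
        nlinarith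

/-- Campanato-type decay of the third differences at a point. -/
lemma exists_oscBound_decay (hκ : 0 < κ) (hτ : 0 ≤ τ) {α : ℝ} (hα0 : 0 < α) (hα1 : α < 1) :
    ∃ C : ℝ, 0 < C ∧ ∀ (ℓ : (E →L[ℝ] E →L[ℝ] ℝ) →ₗ[ℝ] ℝ), IsEllipticForm κ τ ℓ →
      ∀ (u : E → ℝ), ContDiff ℝ 2 u → ∀ (x₀ : E) (r c K M : ℝ), 0 < r → 0 ≤ K →
      (∀ y ∈ closedBall x₀ (4 * r), |ℓ (hess u y) - c| ≤ K * ‖y - x₀‖ ^ α) →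
      (∀ y ∈ closedBall x₀ (4 * r), |u y| ≤ M) →
      ∀ s, 0 < s → s ≤ r → OscBound u x₀ s s s (C * (M / r ^ (2 + α) + K) * s ^ (2 + α)) := by
  set Λ : ℝ := 1 + (2 * τ + 1) / κ with hΛ
  have hΛ0 : 0 < Λ := by positivity
  obtain ⟨l, hl0, hl32, hlX, hlh⟩ : ∃ l : ℝ, 0 < l ∧ l ≤ 1 / 32 ∧ 64 * Λ * l ≤ 1 ∧
      (64 * Λ) ^ 3 * l ^ (1 - α) ≤ 1 / 2 := by
    have t1 : Filter.Tendsto (fun l : ℝ => 64 * Λ * l) (nhdsWithin 0 (Set.Ioi 0)) (nhds 0) := by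
      have : Filter.Tendsto (fun l : ℝ => 64 * Λ * l) (nhds 0) (nhds (64 * Λ * 0)) :=
        (continuous_const.mul continuous_id).tendsto 0
      rw [mul_zero] at this
      exact this.mono_left nhdsWithin_le_nhds
    have t2 : Filter.Tendsto (fun l : ℝ => (64 * Λ) ^ 3 * l ^ (1 - α))
        (nhdsWithin 0 (Set.Ioi 0)) (nhds 0) := by
      have : Filter.Tendsto (fun l : ℝ => (64 * Λ) ^ 3 * l ^ (1 - α)) (nhds 0)
          (nhds ((64 * Λ) ^ 3 * 0 ^ (1 - α))) :=
        (continuous_const.mul (Real.continuous_rpow_const (by linarith))).tendsto 0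
      rw [Real.zero_rpow (by linarith), mul_zero] at this
      exact this.mono_left nhdsWithin_le_nhds
    have t3 : ∀ᶠ l : ℝ in nhdsWithin 0 (Set.Ioi 0), l ≤ 1 / 32 :=
      nhdsWithin_le_nhds (Iic_mem_nhds (by norm_num))
    have t4 : ∀ᶠ l : ℝ in nhdsWithin 0 (Set.Ioi 0), 0 < l := self_mem_nhdsWithin
    obtain ⟨l, h⟩ := (t4.and (t3.and ((t1.eventually_le_const zero_lt_one).and
      (t2.eventually_le_const one_half_pos)))).exists
    exact ⟨l, h⟩
  have hp0 : 0 < l ^ (2 + α) := Real.rpow_pos_of_pos hl0 _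
  refine ⟨(8 + 24 / l ^ (2 + α)) / l ^ (2 + α), by positivity, ?_⟩
  intro ℓ hℓ u hu x₀ r c K M hr hK hLu hM s hs hsr
  have hM0 : 0 ≤ M := (abs_nonneg _).trans (hM x₀ (mem_closedBall_self (by positivity)))
  have hrp : 0 < r ^ (2 + α) := Real.rpow_pos_of_pos hr _
  set B : ℝ := 8 * (M / r ^ (2 + α)) + 24 * K / l ^ (2 + α) with hB
  have hB0 : 0 ≤ B := by positivity
  have hX3 : (64 * Λ * l) ^ 3 ≤ l ^ (2 + α) / 2 := by
    have e1 : l ^ 3 = l ^ (1 - α) * l ^ (2 + α) := by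
      rw [← Real.rpow_add hl0, ← Real.rpow_natCast]
      norm_num
    rw [mul_pow, e1, ← mul_assoc]
    nlinarith
  have hdecay : ∀ n : ℕ, OscBound u x₀ (l ^ n * r) (l ^ n * r) (l ^ n * r)
      (B * (l ^ n * r) ^ (2 + α)) := by
    intro n
    induction n with
    | zero =>
      simp only [pow_zero, one_mul]
      intro h k hh hk y hy z hz
      have hb : ∀ w : E, ‖w - x₀‖ ≤ 4 * r → |u w| ≤ M := fun w hw =>
        hM w (mem_closedBall_iff_norm.2 hw)
      have hp : ∀ w ∈ closedBall x₀ r, ∀ v : E, ‖v‖ ≤ 2 * r → |u (w + v)| ≤ M := by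
        intro w hw v hv
        apply hb
        rw [mem_closedBall_iff_norm] at hw
        calc ‖w + v - x₀‖ = ‖(w - x₀) + v‖ := by congr 1; abel
          _ ≤ ‖w - x₀‖ + ‖v‖ := norm_add_le _ _
          _ ≤ _ := by linarith
      have hd : ∀ w ∈ closedBall x₀ r, |shiftDiff h (shiftDiff k u) w| ≤ 4 * M := by
        intro w hw
        have h1 := abs_le.1 (hp w hw 0 (by simp; positivity))
        have h2 := abs_le.1 (hp w hw h (by linarith))
        have h3 := abs_le.1 (hp w hw k (by linarith))
        have h4 := abs_le.1 (hp w hw (h + k) ((norm_add_le _ _).trans (by linarith)))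
        rw [add_zero] at h1
        rw [← add_assoc] at h4
        simp only [shiftDiff]
        rw [abs_le]
        constructor <;> linarith [h1.1, h1.2, h2.1, h2.2, h3.1, h3.2, h4.1, h4.2]
      have h1 := abs_le.1 (hd y hy)
      have h2 := abs_le.1 (hd z hz)
      have h3 : 8 * M ≤ B * r ^ (2 + α) := by
        have : 8 * M = 8 * (M / r ^ (2 + α)) * r ^ (2 + α) := by field_simp
        rw [this, hB]
        gcongr
        have : 0 ≤ 24 * K / l ^ (2 + α) := by positivity
        linarith
      linarith [h1.2, h2.1]
    | succ n ih =>
      have hρ : 0 < l ^ n * r := by positivity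
      have hρr : l ^ n * r ≤ r :=
        mul_le_of_le_one_left hr.le (pow_le_one₀ hl0.le (by linarith))
      set ρ := l ^ n * r with hρd
      have hε : ∀ y ∈ closedBall x₀ (4 * ρ), |ℓ (hess u y) - c| ≤ K * (4 * ρ ^ α) := by
        intro y hy
        refine (hLu y (closedBall_subset_closedBall (by linarith) hy)).trans ?_
        gcongr
        rw [mem_closedBall_iff_norm] at hy
        calc ‖y - x₀‖ ^ α ≤ (4 * ρ) ^ α := by gcongr
          _ = 4 ^ α * ρ ^ α := Real.mul_rpow (by norm_num) hρ.le
          _ ≤ 4 * ρ ^ α := by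
            gcongr
            exact Real.rpow_le_self_of_one_le (by norm_num) hα1.le
      have hs := OscBound.scale hu hκ hτ hℓ hρ (by positivity) (by positivity) ih hε hl0 hl32
        rfl hlX
      have e1 : l ^ (n + 1) * r = l * ρ := by rw [hρd]; ring
      rw [e1]
      refine hs.mono le_rfl le_rfl le_rfl ?_
      rw [← hΛ, Real.mul_rpow hl0.le hρ.le]
      have e2 : ρ ^ (2 + α) = ρ ^ 2 * ρ ^ α := by
        rw [Real.rpow_add hρ, Real.rpow_two]
      have h1 : (64 * Λ * l) ^ 3 * (B * ρ ^ (2 + α)) ≤ l ^ (2 + α) / 2 * (B * ρ ^ (2 + α)) := by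
        gcongr
      have h2 : 24 * K ≤ B * l ^ (2 + α) := by
        have : 24 * K = 24 * K / l ^ (2 + α) * l ^ (2 + α) := by field_simp
        rw [this, hB]
        gcongr
        have : 0 ≤ 8 * (M / r ^ (2 + α)) := by positivity
        linarith
      have h3 := mul_le_mul_of_nonneg_right h2 (by positivity : 0 ≤ ρ ^ (2 + α))
      rw [e2] at h1 h3 ⊢
      nlinarith
  obtain ⟨n, hn1, hn2⟩ := exists_nat_pow_near_of_lt_one (x := s / r) (y := l) (by positivity)
    ((div_le_one hr).2 hsr) hl0 (by linarith)
  rw [lt_div_iff₀ hr] at hn1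
  rw [div_le_iff₀ hr] at hn2
  refine (hdecay n).mono hn2 hn2 hn2 ?_
  have h1 : l ^ n * r ≤ s / l := by
    rw [le_div_iff₀ hl0]
    calc l ^ n * r * l = l ^ (n + 1) * r := by ring
      _ ≤ s := hn1.le
  calc B * (l ^ n * r) ^ (2 + α) ≤ B * (s / l) ^ (2 + α) := by gcongr
    _ = B / l ^ (2 + α) * s ^ (2 + α) := by rw [Real.div_rpow hs.le hl0.le]; ring
    _ ≤ _ := by
      gcongr
      have hMr : 0 ≤ M / r ^ (2 + α) := by positivity
      have : 0 ≤ 24 / l ^ (2 + α) * (M / r ^ (2 + α)) := by positivity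
      rw [div_mul_eq_mul_div]
      gcongr
      have e3 : (8 + 24 / l ^ (2 + α)) * (M / r ^ (2 + α) + K)
        = B + 24 / l ^ (2 + α) * (M / r ^ (2 + α)) + 8 * K := by rw [hB]; ring
      rw [e3]
      linarith

end Decay

section HessianBounds

variable {E : Type*} [NormedAddCommGroup E] [NormedSpace ℝ E]

lemma norm_bilin_le_of_unit {Q : E →L[ℝ] E →L[ℝ] ℝ} {N : ℝ} (hN : 0 ≤ N)
    (hQ : ∀ h k : E, ‖h‖ ≤ 1 → ‖k‖ ≤ 1 → |Q k h| ≤ N) : ‖Q‖ ≤ N :=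
  ContinuousLinearMap.opNorm_le_of_unit_norm hN fun k hk =>
    ContinuousLinearMap.opNorm_le_of_unit_norm hN fun h hh => hQ h k hh.le hk.le

lemma abs_shiftDiff_quot_sub_hess_le {u : E → ℝ} (hu : ContDiff ℝ 2 u) {α : ℝ} (hα0 : 0 < α)
    {x₀ : E} {r B : ℝ} (hosc : ∀ s, 0 < s → s ≤ r → OscBound u x₀ s s s (B * s ^ (2 + α)))
    {h k : E} (hh : ‖h‖ ≤ 1) (hk : ‖k‖ ≤ 1) {s : ℝ} (hs : 0 < s) (hsr : s ≤ r) :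
    |shiftDiff (s • h) (shiftDiff (s • k) u) x₀ / s ^ 2 - hess u x₀ k h|
      ≤ 3 / (1 - 2⁻¹ ^ α) * B * s ^ α := by
  set D : ℝ → ℝ := fun s => shiftDiff (s • h) (shiftDiff (s • k) u) x₀ / s ^ 2 with hD
  have h2α : (2⁻¹ : ℝ) ^ α < 1 := Real.rpow_lt_one (by norm_num) (by norm_num) hα0
  have hstep : ∀ t, 0 < t → t ≤ r → |D t - D (t / 2)| ≤ 3 * B * t ^ α := by
    intro t ht htr
    obtain ⟨σ, rfl⟩ : ∃ σ, t = 2 * σ := ⟨t / 2, by ring⟩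
    have hσ : 0 < σ := by linarith
    have nh : ‖σ • h‖ ≤ σ := by
      rw [norm_smul, norm_of_nonneg hσ.le]; exact mul_le_of_le_one_right hσ.le hh
    have nk : ‖σ • k‖ ≤ σ := by
      rw [norm_smul, norm_of_nonneg hσ.le]; exact mul_le_of_le_one_right hσ.le hk
    have hmem : ∀ w : E, ‖w‖ ≤ 2 * σ → x₀ + w ∈ closedBall x₀ (2 * σ) := by
      intro w hw
      rwa [mem_closedBall_iff_norm, add_sub_cancel_left]
    have hx := hmem 0 (by simp; positivity)
    rw [add_zero] at hx
    set g := shiftDiff (σ • h) (shiftDiff (σ • k) u) with hg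
    have b := fun w hw => (hosc (2 * σ) ht htr).abs_le (h := σ • h) (k := σ • k)
      (y := x₀ + w) (z := x₀) (by linarith) (by linarith) (hmem w hw) hx
    have b1 := abs_le.1 (b (σ • h) (by linarith))
    have b2 := abs_le.1 (b (σ • k) (by linarith))
    have b3 := abs_le.1 (b (σ • h + σ • k) ((norm_add_le _ _).trans (by linarith)))
    rw [← hg] at b1 b2 b3
    have hsum : shiftDiff ((2 * σ) • h) (shiftDiff ((2 * σ) • k) u) x₀
        = g x₀ + g (x₀ + σ • h) + g (x₀ + σ • k) + g (x₀ + (σ • h + σ • k)) := by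
      have e1 : x₀ + (2 * σ) • h = x₀ + σ • h + σ • h := by module
      have e2 : x₀ + σ • h + σ • h + (2 * σ) • k = x₀ + (σ • h + σ • k) + σ • h + σ • k := by
        module
      have e3 : x₀ + (2 * σ) • k = x₀ + σ • k + σ • k := by module
      have e4 : x₀ + σ • h + σ • k = x₀ + (σ • h + σ • k) := by module
      have e5 : x₀ + σ • k + σ • h = x₀ + (σ • h + σ • k) := by module
      have e7 : x₀ + (σ • h + σ • k) + σ • h = x₀ + σ • h + σ • h + σ • k := by module
      simp only [hg, shiftDiff, e1, e2, e3, e4, e5, e7]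
      ring
    have hq : D (2 * σ) - D (2 * σ / 2)
        = (shiftDiff ((2 * σ) • h) (shiftDiff ((2 * σ) • k) u) x₀ - 4 * g x₀) / (2 * σ) ^ 2 := by
      have : 2 * σ / 2 = σ := by ring
      simp only [hD, this, hg]
      field_simp
      ring
    rw [hq, abs_div, abs_of_pos (by positivity : 0 < (2 * σ) ^ 2), div_le_iff₀ (by positivity),
      hsum]
    have e8 : 3 * B * (2 * σ) ^ α * (2 * σ) ^ 2 = 3 * (B * (2 * σ) ^ (2 + α)) := by
      rw [Real.rpow_add ht, Real.rpow_two]; ring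
    rw [e8, abs_le]
    constructor <;> linarith [b1.1, b1.2, b2.1, b2.2, b3.1, b3.2]
  set c : ℝ := 3 / (1 - 2⁻¹ ^ α) with hc
  have hc3 : c * (1 - 2⁻¹ ^ α) = 3 := div_mul_cancel₀ _ (by linarith)
  have hpos : ∀ n : ℕ, 0 < s * 2⁻¹ ^ n := fun n => by positivity
  have htel : ∀ n : ℕ, |D s - D (s * 2⁻¹ ^ n)| ≤ c * B * (s ^ α - (s * 2⁻¹ ^ n) ^ α) := by
    intro n
    induction n with
    | zero => simp
    | succ n ih =>
      have hle : s * 2⁻¹ ^ n ≤ r :=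
        (mul_le_of_le_one_right hs.le (pow_le_one₀ (by norm_num) (by norm_num))).trans hsr
      have h1 := hstep _ (hpos n) hle
      have e1 : s * 2⁻¹ ^ (n + 1) = s * 2⁻¹ ^ n * 2⁻¹ := by rw [pow_succ]; ring
      rw [div_eq_mul_inv, ← e1] at h1
      have e2 : (s * 2⁻¹ ^ (n + 1)) ^ α = (s * 2⁻¹ ^ n) ^ α * 2⁻¹ ^ α := by
        rw [e1, Real.mul_rpow (hpos n).le (by norm_num)]
      have e3 : c * B * (s ^ α - (s * 2⁻¹ ^ (n + 1)) ^ α)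
          = c * B * (s ^ α - (s * 2⁻¹ ^ n) ^ α) + 3 * B * (s * 2⁻¹ ^ n) ^ α := by
        rw [e2, ← hc3]; ring
      rw [e3]
      exact (abs_sub_le _ _ _).trans (add_le_add ih h1)
  have hB : 0 ≤ B := by
    have h1 := hosc s hs hsr 0 0 (by simpa using hs.le) (by simpa using hs.le) x₀
      (mem_closedBall_self hs.le) x₀ (mem_closedBall_self hs.le)
    rw [sub_self] at h1
    exact nonneg_of_mul_nonneg_left h1 (Real.rpow_pos_of_pos hs _)
  have hc0 : 0 ≤ c := div_nonneg (by norm_num) (by linarith)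
  have hlim : Filter.Tendsto (fun n : ℕ => |D s - D (s * 2⁻¹ ^ n)|) Filter.atTop
      (nhds |D s - hess u x₀ k h|) := by
    have h0 : Filter.Tendsto (fun n : ℕ => s * (2⁻¹ : ℝ) ^ n) Filter.atTop
        (nhdsWithin 0 (Set.Ioi 0)) := by
      refine tendsto_nhdsWithin_iff.2 ⟨?_, Filter.Eventually.of_forall hpos⟩
      simpa using (tendsto_pow_atTop_nhds_zero_of_lt_one (r := (2⁻¹ : ℝ)) (by norm_num)
        (by norm_num)).const_mul s
    have h1 : Filter.Tendsto D (nhdsWithin 0 (Set.Ioi 0)) (nhds (hess u x₀ k h)) := by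
      simpa using tendsto_shiftDiff_div_sq hu x₀ 0 h k
    exact ((h1.comp h0).const_sub (D s)).abs
  refine le_of_tendsto hlim (Filter.Eventually.of_forall fun n => (htel n).trans ?_)
  have : 0 ≤ (s * 2⁻¹ ^ n) ^ α := Real.rpow_nonneg (hpos n).le _
  have := mul_nonneg (mul_nonneg hc0 hB) this
  linarith

lemma norm_hess_le_of_oscBound {u : E → ℝ} (hu : ContDiff ℝ 2 u) {α : ℝ} (hα0 : 0 < α)
    {x₀ : E} {r B M : ℝ} (hr : 0 < r) (hB : 0 ≤ B)
    (hosc : ∀ s, 0 < s → s ≤ r → OscBound u x₀ s s s (B * s ^ (2 + α))) (hM : ∀ y, |u y| ≤ M) :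
    ‖hess u x₀‖ ≤ 4 * M / r ^ 2 + 3 / (1 - 2⁻¹ ^ α) * B * r ^ α := by
  have h2α : (2⁻¹ : ℝ) ^ α < 1 := Real.rpow_lt_one (by norm_num) (by norm_num) hα0
  have h3 : 0 ≤ 3 / (1 - (2⁻¹ : ℝ) ^ α) := div_nonneg (by norm_num) (by linarith)
  have hM0 : 0 ≤ M := (abs_nonneg _).trans (hM x₀)
  refine norm_bilin_le_of_unit (by positivity) fun h k hh hk => ?_
  have h1 := abs_le.1 (abs_shiftDiff_quot_sub_hess_le hu hα0 hosc hh hk hr le_rfl)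
  have h2 : |shiftDiff (r • h) (shiftDiff (r • k) u) x₀ / r ^ 2| ≤ 4 * M / r ^ 2 := by
    rw [abs_div, abs_of_pos (by positivity : 0 < r ^ 2)]
    gcongr
    have m1 := abs_le.1 (hM x₀)
    have m2 := abs_le.1 (hM (x₀ + r • h))
    have m3 := abs_le.1 (hM (x₀ + r • k))
    have m4 := abs_le.1 (hM (x₀ + r • h + r • k))
    simp only [shiftDiff]
    rw [abs_le]
    constructor <;> linarith [m1.1, m1.2, m2.1, m2.2, m3.1, m3.2, m4.1, m4.2]
  have h2 := abs_le.1 h2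
  rw [abs_le]
  constructor <;> linarith [h1.1, h1.2, h2.1, h2.2]

lemma norm_hess_sub_hess_le {u : E → ℝ} (hu : ContDiff ℝ 2 u) {α : ℝ} (hα0 : 0 < α)
    {r B : ℝ} (hB : 0 ≤ B)
    (hosc : ∀ x s, 0 < s → s ≤ r → OscBound u x s s s (B * s ^ (2 + α))) {x y : E}
    (hxy : ‖x - y‖ ≤ r) :
    ‖hess u x - hess u y‖ ≤ (2 * (3 / (1 - 2⁻¹ ^ α)) + 1) * B * ‖x - y‖ ^ α := by
  have h2α : (2⁻¹ : ℝ) ^ α < 1 := Real.rpow_lt_one (by norm_num) (by norm_num) hα0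
  have h3 : 0 ≤ 3 / (1 - (2⁻¹ : ℝ) ^ α) := div_nonneg (by norm_num) (by linarith)
  rcases eq_or_ne x y with rfl | hne
  · refine norm_bilin_le_of_unit (by positivity) fun h k _ _ => ?_
    have e : (hess u x - hess u x) k h = hess u x k h - hess u x k h := rfl
    rw [e, sub_self, abs_zero]
    positivity
  set s := ‖x - y‖ with hs
  have hs0 : 0 < s := norm_pos_iff.2 (sub_ne_zero.2 hne)
  refine norm_bilin_le_of_unit (by positivity) fun h k hh hk => ?_
  have h1 := abs_le.1 (abs_shiftDiff_quot_sub_hess_le hu hα0 (hosc x) hh hk hs0 hxy)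
  have h2 := abs_le.1 (abs_shiftDiff_quot_sub_hess_le hu hα0 (hosc y) hh hk hs0 hxy)
  have nh : ‖s • h‖ ≤ s := by
    rw [norm_smul, norm_of_nonneg hs0.le]; exact mul_le_of_le_one_right hs0.le hh
  have nk : ‖s • k‖ ≤ s := by
    rw [norm_smul, norm_of_nonneg hs0.le]; exact mul_le_of_le_one_right hs0.le hk
  have h4 : |shiftDiff (s • h) (shiftDiff (s • k) u) x / s ^ 2
      - shiftDiff (s • h) (shiftDiff (s • k) u) y / s ^ 2| ≤ B * s ^ α := by
    rw [← sub_div, abs_div, abs_of_pos (by positivity : 0 < s ^ 2), div_le_iff₀ (by positivity)]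
    have e8 : B * s ^ α * s ^ 2 = B * s ^ (2 + α) := by
      rw [Real.rpow_add hs0, Real.rpow_two]; ring
    rw [e8]
    exact (hosc x s hs0 hxy).abs_le nh nk (mem_closedBall_self hs0.le)
      (mem_closedBall_iff_norm'.2 le_rfl)
  have h4 := abs_le.1 h4
  have e : (hess u x - hess u y) k h = hess u x k h - hess u y k h := rfl
  rw [e, abs_le]
  constructor <;> linarith [h1.1, h1.2, h2.1, h2.2, h4.1, h4.2]

end HessianBounds

section TraceForm

variable {d : ℕ}

/-- The functional `Q ↦ tr (S Q)` on bilinear forms. -/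
def traceForm (S : Matrix (Fin d) (Fin d) ℝ) :
    (EuclideanSpace ℝ (Fin d) →L[ℝ] EuclideanSpace ℝ (Fin d) →L[ℝ] ℝ) →ₗ[ℝ] ℝ where
  toFun Q := ∑ i, ∑ j, S i j * Q (EuclideanSpace.single j 1) (EuclideanSpace.single i 1)
  map_add' P Q := by simp [mul_add, Finset.sum_add_distrib]
  map_smul' c Q := by simp [Finset.mul_sum, mul_left_comm]

lemma traceForm_apply (S : Matrix (Fin d) (Fin d) ℝ)
    (Q : EuclideanSpace ℝ (Fin d) →L[ℝ] EuclideanSpace ℝ (Fin d) →L[ℝ] ℝ) :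
    traceForm S Q
      = ∑ i, ∑ j, S i j * Q (EuclideanSpace.single j 1) (EuclideanSpace.single i 1) :=
  rfl

lemma traceForm_sub (S T : Matrix (Fin d) (Fin d) ℝ)
    (Q : EuclideanSpace ℝ (Fin d) →L[ℝ] EuclideanSpace ℝ (Fin d) →L[ℝ] ℝ) :
    traceForm (S - T) Q = traceForm S Q - traceForm T Q := by
  simp [traceForm_apply, sub_mul, Finset.sum_sub_distrib]

lemma bilin_apply_eq_sum
    (Q : EuclideanSpace ℝ (Fin d) →L[ℝ] EuclideanSpace ℝ (Fin d) →L[ℝ] ℝ)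
    (x y : EuclideanSpace ℝ (Fin d)) :
    Q x y = ∑ i, ∑ j, x j * y i * Q (EuclideanSpace.single j 1) (EuclideanSpace.single i 1) := by
  have h : ∀ z : EuclideanSpace ℝ (Fin d), z = ∑ i, z i • EuclideanSpace.single i (1 : ℝ) := by
    intro z
    simpa using ((EuclideanSpace.basisFun (Fin d) ℝ).sum_repr z).symm
  conv_lhs => rw [h x, h y]
  simp only [map_sum, map_smul, sum_apply, smul_apply, smul_eq_mul,
    Finset.mul_sum]
  exact Finset.sum_congr rfl fun i _ => Finset.sum_congr rfl fun j _ => by ring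

open scoped MatrixOrder in
lemma exists_traceForm_eq_sum {M : Matrix (Fin d) (Fin d) ℝ} (hM : M.PosSemidef) :
    ∃ c : Fin d → EuclideanSpace ℝ (Fin d), ∑ k, ‖c k‖ ^ 2 = ∑ i, M i i ∧
      ∀ Q, traceForm M Q = ∑ k, Q (c k) (c k) := by
  obtain ⟨B, hB⟩ : ∃ B : Matrix (Fin d) (Fin d) ℝ, M = B.conjTranspose * B :=
    CStarAlgebra.nonneg_iff_eq_star_mul_self.1 hM.nonneg
  have key : ∀ Q : EuclideanSpace ℝ (Fin d) →L[ℝ] EuclideanSpace ℝ (Fin d) →L[ℝ] ℝ,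
      traceForm M Q = ∑ k, Q (WithLp.toLp 2 (B k)) (WithLp.toLp 2 (B k)) := by
    intro Q
    simp_rw [bilin_apply_eq_sum Q (WithLp.toLp 2 (B _)), traceForm_apply, hB, Matrix.mul_apply,
      Matrix.conjTranspose_apply, star_trivial, Finset.sum_mul]
    symm
    rw [Finset.sum_comm]
    refine Finset.sum_congr rfl fun i _ => ?_
    rw [Finset.sum_comm]
    exact Finset.sum_congr rfl fun j _ => Finset.sum_congr rfl fun k _ => by ring
  refine ⟨fun k => WithLp.toLp 2 (B k), ?_, key⟩
  simp_rw [EuclideanSpace.real_norm_sq_eq, hB, Matrix.mul_apply, Matrix.conjTranspose_apply,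
    star_trivial, ← sq]
  exact Finset.sum_comm

lemma posSemidef_sub_vecMulVec {S : Matrix (Fin d) (Fin d) ℝ} {κ : ℝ} (hκ : 0 ≤ κ)
    (hS : S.IsSymm)
    (hell : ∀ ξ : Fin d → ℝ, κ * ∑ i, ξ i ^ 2 ≤ ∑ i, ∑ j, ξ i * S i j * ξ j)
    {e : EuclideanSpace ℝ (Fin d)} (he : ‖e‖ ≤ 1) :
    (S - κ • Matrix.vecMulVec e.ofLp e.ofLp).PosSemidef := by
  refine Matrix.PosSemidef.of_dotProduct_mulVec_nonneg ?_ fun ξ => ?_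
  · ext i j
    simp [Matrix.vecMulVec_apply, hS.apply i j, mul_comm]
  · have h1 : (star ξ) ⬝ᵥ ((S - κ • Matrix.vecMulVec e.ofLp e.ofLp).mulVec ξ)
        = ∑ i, ∑ j, ξ i * S i j * ξ j - κ * (∑ i, ξ i * e i) ^ 2 := by
      simp only [dotProduct, Matrix.mulVec, Finset.mul_sum, sq, Finset.sum_mul,
        ← Finset.sum_sub_distrib]
      refine Finset.sum_congr rfl fun i _ => Finset.sum_congr rfl fun j _ => ?_
      simp [Matrix.vecMulVec_apply]
      ring
    have h2 : (∑ i, ξ i * e i) ^ 2 ≤ (∑ i, ξ i ^ 2) * ∑ i, e i ^ 2 :=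
      Finset.sum_mul_sq_le_sq_mul_sq _ _ _
    have h3 : ∑ i, e i ^ 2 ≤ 1 := by
      rw [← EuclideanSpace.real_norm_sq_eq]
      exact pow_le_one₀ (norm_nonneg _) he
    have h4 : (∑ i, ξ i * e i) ^ 2 ≤ ∑ i, ξ i ^ 2 :=
      h2.trans (mul_le_of_le_one_right (by positivity) h3)
    rw [h1]
    nlinarith [hell ξ]

lemma isEllipticForm_traceForm {S : Matrix (Fin d) (Fin d) ℝ} {κ A : ℝ} (hκ : 0 ≤ κ)
    (hS : S.IsSymm)
    (hell : ∀ ξ : Fin d → ℝ, κ * ∑ i, ξ i ^ 2 ≤ ∑ i, ∑ j, ξ i * S i j * ξ j)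
    (hA : ∀ i j, |S i j| ≤ A) :
    IsEllipticForm κ (d * A) (traceForm S) := by
  intro e he
  obtain ⟨c, hc, hcQ⟩ := exists_traceForm_eq_sum (posSemidef_sub_vecMulVec hκ hS hell he.le)
  refine ⟨d, c, ?_, fun Q => ?_⟩
  · have h3 : ∑ i, e i ^ 2 = 1 := by
      rw [← EuclideanSpace.real_norm_sq_eq, he, one_pow]
    have h4 : ∑ i, S i i ≤ ∑ _i : Fin d, A :=
      Finset.sum_le_sum fun i _ => (le_abs_self _).trans (hA i i)
    have h5 : ∑ i, (S - κ • Matrix.vecMulVec e.ofLp e.ofLp) i i = ∑ i, S i i - κ := by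
      simp only [Matrix.sub_apply, Matrix.smul_apply, Matrix.vecMulVec_apply, smul_eq_mul,
        Finset.sum_sub_distrib, ← Finset.mul_sum, ← sq, h3, mul_one]
    rw [hc, h5]
    simpa using h4
  · rw [← hcQ, traceForm_sub, bilin_apply_eq_sum Q e e]
    simp only [traceForm_apply, Matrix.smul_apply, Matrix.vecMulVec_apply, smul_eq_mul,
      Finset.mul_sum]
    simp [mul_assoc, mul_left_comm]

lemma abs_traceForm_le {S : Matrix (Fin d) (Fin d) ℝ} {a : ℝ} (hS : ∀ i j, |S i j| ≤ a)
    (Q : EuclideanSpace ℝ (Fin d) →L[ℝ] EuclideanSpace ℝ (Fin d) →L[ℝ] ℝ) :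
    |traceForm S Q| ≤ d ^ 2 * a * ‖Q‖ := by
  have h : ∀ i j, |S i j * Q (EuclideanSpace.single j 1) (EuclideanSpace.single i 1)|
      ≤ a * ‖Q‖ := by
    intro i j
    have := Q.le_opNorm₂ (EuclideanSpace.single j 1) (EuclideanSpace.single i 1)
    simp only [PiLp.norm_single, norm_one, mul_one, norm_eq_abs] at this
    rw [abs_mul]
    exact mul_le_mul (hS i j) this (abs_nonneg _) ((abs_nonneg _).trans (hS i j))
  rw [traceForm_apply]
  calc |_| ≤ ∑ _i : Fin d, ∑ _j : Fin d, a * ‖Q‖ :=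
        (Finset.abs_sum_le_sum_abs _ _).trans (Finset.sum_le_sum fun i _ =>
          (Finset.abs_sum_le_sum_abs _ _).trans (Finset.sum_le_sum fun j _ => h i j))
    _ = d ^ 2 * a * ‖Q‖ := by simp; ring

end TraceForm

section MaximumPrinciple

variable {d : ℕ}

/-- `w` is a bounded `C²` solution of `w = r + b · Dw + tr (S D²w) / 2`, where `S ≥ κ I` is
symmetric and `r`, `b`, `S` have `C^{0,α}` norms bounded by `A`. -/
structure IsUnitSolution (κ A α : ℝ) (r : EuclideanSpace ℝ (Fin d) → ℝ)
    (b : EuclideanSpace ℝ (Fin d) → Fin d → ℝ)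
    (S : EuclideanSpace ℝ (Fin d) → Matrix (Fin d) (Fin d) ℝ)
    (w : EuclideanSpace ℝ (Fin d) → ℝ) : Prop where
  isSymm : ∀ x, (S x).IsSymm
  elliptic : ∀ x (ξ : Fin d → ℝ), κ * ∑ i, ξ i ^ 2 ≤ ∑ i, ∑ j, ξ i * S x i j * ξ j
  abs_source_le : ∀ x, |r x| ≤ A
  source_holder : ∀ x y, dist x y ≤ 1 → |r x - r y| ≤ A * dist x y ^ α
  abs_drift_le : ∀ x i, |b x i| ≤ A
  drift_holder : ∀ x y, dist x y ≤ 1 → ∀ i, |b x i - b y i| ≤ A * dist x y ^ α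
  abs_diffusion_le : ∀ x i j, |S x i j| ≤ A
  diffusion_holder : ∀ x y, dist x y ≤ 1 → ∀ i j, |S x i j - S y i j| ≤ A * dist x y ^ α
  contDiff : ContDiff ℝ 2 w
  bounded : ∃ M, ∀ x, |w x| ≤ M
  eqn : ∀ x, w x = r x + ∑ i, b x i * fderiv ℝ w x (EuclideanSpace.single i 1)
    + 1 / 2 * traceForm (S x) (hess w x)

namespace IsUnitSolution

variable {κ A α : ℝ} {r : EuclideanSpace ℝ (Fin d) → ℝ}
  {b : EuclideanSpace ℝ (Fin d) → Fin d → ℝ}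
  {S : EuclideanSpace ℝ (Fin d) → Matrix (Fin d) (Fin d) ℝ} {w : EuclideanSpace ℝ (Fin d) → ℝ}

lemma neg (h : IsUnitSolution κ A α r b S w) :
    IsUnitSolution κ A α (fun x => -r x) b S (fun x => -w x) where
  isSymm := h.isSymm
  elliptic := h.elliptic
  abs_source_le x := by rw [abs_neg]; exact h.abs_source_le x
  source_holder x y hxy := by
    rw [← abs_neg, neg_sub, neg_sub_neg, abs_sub_comm, abs_sub_comm]
    exact h.source_holder x y hxy
  abs_drift_le := h.abs_drift_le
  drift_holder := h.drift_holder
  abs_diffusion_le := h.abs_diffusion_le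
  diffusion_holder := h.diffusion_holder
  contDiff := h.contDiff.neg
  bounded := by simpa only [abs_neg] using h.bounded
  eqn x := by
    have h1 : fderiv ℝ (fun x => -w x) = fun x => -fderiv ℝ w x := by
      funext x
      exact fderiv_fun_neg
    have h2 : hess (fun x => -w x) x = -hess w x := by
      rw [hess, h1, fderiv_fun_neg, hess]
    have h3 : ∀ Q, traceForm (S x) (-Q) = -traceForm (S x) Q := fun Q => (traceForm (S x)).map_neg Q
    rw [h2, h1, h3, h.eqn x]
    simp only [neg_apply, mul_neg, Finset.sum_neg_distrib]
    ring

lemma le_sup (h : IsUnitSolution κ A α r b S w) (hκ : 0 ≤ κ) (hA : 0 ≤ A)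
    (x : EuclideanSpace ℝ (Fin d)) : w x ≤ A := by
  obtain ⟨M, hM⟩ := h.bounded
  set D : ℝ := d * A with hD
  have hD0 : 0 ≤ D := by positivity
  suffices H : ∀ δ : ℝ, 0 < δ → w x ≤ A + δ * (‖x‖ ^ 2 + D + D ^ 2 + 1) by
    refine le_of_forall_pos_le_add fun ε hε => ?_
    have hp : 0 < ‖x‖ ^ 2 + D + D ^ 2 + 1 := by positivity
    simpa [div_mul_cancel₀ _ hp.ne'] using H (ε / (‖x‖ ^ 2 + D + D ^ 2 + 1)) (div_pos hε hp)
  intro δ hδ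
  set g : EuclideanSpace ℝ (Fin d) → ℝ := fun y => w y - δ * ‖y‖ ^ 2 with hg
  have hgc : Continuous g := by
    have := h.contDiff.continuous
    fun_prop
  obtain ⟨x₁, hx₁⟩ : ∃ x₁, ∀ y, g y ≤ g x₁ := by
    refine hgc.exists_forall_ge' (x₀ := 0) ?_
    filter_upwards [(tendsto_norm_cocompact_atTop (E := EuclideanSpace ℝ (Fin d))).eventually
      (Filter.eventually_ge_atTop (max 1 (2 * M / δ)))] with y hy
    have h1 := (le_max_left _ _).trans hy
    have h2 := (le_max_right _ _).trans hy
    rw [div_le_iff₀ hδ] at h2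
    have h3 := abs_le.1 (hM y)
    have h4 := abs_le.1 (hM 0)
    simp only [hg, norm_zero]
    have h5 : ‖y‖ ≤ ‖y‖ ^ 2 := by nlinarith
    nlinarith
  have hgrad : ∀ i, fderiv ℝ w x₁ (EuclideanSpace.single i 1) = 2 * δ * x₁ i := by
    intro i
    have hd : HasFDerivAt g _ x₁ := (hasFDerivAt_of_contDiff_two h.contDiff x₁).sub
      ((hasStrictFDerivAt_norm_sq x₁).hasFDerivAt.const_mul δ)
    have h0 := IsLocalMax.hasFDerivAt_eq_zero (Filter.Eventually.of_forall hx₁) hd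
    have h1 := DFunLike.congr_fun h0 (EuclideanSpace.single i 1)
    simp [EuclideanSpace.inner_single_right] at h1
    linarith
  have hhess : ∀ c, hess w x₁ c c ≤ 2 * δ * ‖c‖ ^ 2 := by
    intro c
    refine le_of_tendsto (tendsto_symm_diff_div_sq h.contDiff x₁ c) ?_
    filter_upwards [self_mem_nhdsWithin] with s hs
    have hs0 : (0 : ℝ) < s := hs
    rw [div_le_iff₀ (by positivity)]
    have h1 := hx₁ (x₁ + s • c)
    have h2 := hx₁ (x₁ - s • c)
    have h3 := norm_add_smul_sq_add_norm_sub_smul_sq x₁ c s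
    simp only [hg] at h1 h2
    linear_combination h1 + h2 + δ * h3
  have htr : traceForm (S x₁) (hess w x₁) ≤ 2 * δ * D := by
    have hpsd : (S x₁).PosSemidef := by
      simpa using posSemidef_sub_vecMulVec (e := 0) hκ (h.isSymm x₁) (h.elliptic x₁) (by simp)
    obtain ⟨c, hc, hcQ⟩ := exists_traceForm_eq_sum hpsd
    rw [hcQ]
    calc ∑ k, hess w x₁ (c k) (c k) ≤ ∑ k, 2 * δ * ‖c k‖ ^ 2 :=
          Finset.sum_le_sum fun k _ => hhess (c k)
      _ = 2 * δ * ∑ i, S x₁ i i := by rw [← Finset.mul_sum, hc]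
      _ ≤ 2 * δ * ∑ _i : Fin d, A := by
          gcongr with i
          exact (le_abs_self _).trans (h.abs_diffusion_le x₁ i i)
      _ = 2 * δ * D := by simp [hD]
  have hdrift : ∑ i, b x₁ i * fderiv ℝ w x₁ (EuclideanSpace.single i 1) ≤ 2 * δ * (D * ‖x₁‖) := by
    calc ∑ i, b x₁ i * fderiv ℝ w x₁ (EuclideanSpace.single i 1)
        ≤ ∑ _i : Fin d, A * (2 * δ * ‖x₁‖) := by
          refine Finset.sum_le_sum fun i _ => ?_
          rw [hgrad]
          refine (le_abs_self _).trans ?_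
          rw [abs_mul, abs_mul, abs_of_pos (by positivity : 0 < 2 * δ)]
          have := PiLp.norm_apply_le x₁ i
          rw [norm_eq_abs] at this
          gcongr
          exact h.abs_drift_le x₁ i
      _ = 2 * δ * (D * ‖x₁‖) := by simp [hD]; ring
  have h1 := hx₁ x
  have h2 := h.eqn x₁
  have h3 := (abs_le.1 (h.abs_source_le x₁)).2
  simp only [hg] at h1
  nlinarith [mul_nonneg hδ.le (sq_nonneg (D - ‖x₁‖))]

lemma abs_le_sup (h : IsUnitSolution κ A α r b S w) (hκ : 0 ≤ κ) (hA : 0 ≤ A)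
    (x : EuclideanSpace ℝ (Fin d)) : |w x| ≤ A :=
  abs_le'.2 ⟨h.le_sup hκ hA x, h.neg.le_sup hκ hA x⟩

end IsUnitSolution

end MaximumPrinciple

section GradientBounds

variable {E : Type*} [NormedAddCommGroup E] [NormedSpace ℝ E]

lemma norm_fderiv_sub_fderiv_le {u : E → ℝ} (hu : ContDiff ℝ 2 u) {s : Set E} (hs : Convex ℝ s)
    {N : ℝ} (hN : ∀ y ∈ s, ‖hess u y‖ ≤ N) {x y : E} (hx : x ∈ s) (hy : y ∈ s) :
    ‖fderiv ℝ u y - fderiv ℝ u x‖ ≤ N * ‖y - x‖ :=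
  hs.norm_image_sub_le_of_norm_hasFDerivWithin_le
    (fun z _ => (hasFDerivAt_fderiv hu z).hasFDerivWithinAt) hN hx hy

lemma norm_fderiv_le_of_hess {u : E → ℝ} (hu : ContDiff ℝ 2 u) {x : E} {s N M : ℝ} (hs : 0 < s)
    (hN : ∀ y ∈ closedBall x s, ‖hess u y‖ ≤ N) (hM : ∀ y, |u y| ≤ M) :
    ‖fderiv ℝ u x‖ ≤ 2 * M / s + N * s := by
  have hxs : x ∈ closedBall x s := mem_closedBall_self hs.le
  have hN0 : 0 ≤ N := (norm_nonneg (hess u x)).trans (hN x hxs)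
  have hM0 : 0 ≤ M := (abs_nonneg _).trans (hM x)
  refine ContinuousLinearMap.opNorm_le_of_unit_norm (by positivity) fun k hk => ?_
  have hsk : ‖s • k‖ = s := by rw [norm_smul, hk, mul_one, norm_of_nonneg hs.le]
  have hmem : x + s • k ∈ closedBall x s := by
    rw [mem_closedBall_iff_norm, add_sub_cancel_left, hsk]
  have hg : ∀ y ∈ closedBall x s, ‖fderiv ℝ u y - fderiv ℝ u x‖ ≤ N * s := fun y hy =>
    (norm_fderiv_sub_fderiv_le hu (convex_closedBall x s) hN hxs hy).trans
      (mul_le_mul_of_nonneg_left (mem_closedBall_iff_norm.1 hy) hN0)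
  have h1 := (convex_closedBall x s).norm_image_sub_le_of_norm_hasFDerivWithin_le'
    (fun z _ => (hasFDerivAt_of_contDiff_two hu z).hasFDerivWithinAt) hg hxs hmem
  rw [add_sub_cancel_left, hsk, map_smul, norm_eq_abs, smul_eq_mul] at h1
  have h1 := abs_le.1 h1
  have h2 := abs_le.1 (hM x)
  have h3 := abs_le.1 (hM (x + s • k))
  have h4 : |s * fderiv ℝ u x k| ≤ 2 * M + N * s * s :=
    abs_le.2 ⟨by linarith [h1.2, h2.2, h3.1], by linarith [h1.1, h2.1, h3.2]⟩
  rw [abs_mul, abs_of_pos hs] at h4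
  rw [norm_eq_abs, div_add' _ _ _ hs.ne', le_div_iff₀ hs]
  linarith

end GradientBounds

section InteriorHessian

variable {d : ℕ}

namespace IsUnitSolution

variable {κ A α : ℝ} {r : EuclideanSpace ℝ (Fin d) → ℝ}
  {b : EuclideanSpace ℝ (Fin d) → Fin d → ℝ}
  {S : EuclideanSpace ℝ (Fin d) → Matrix (Fin d) (Fin d) ℝ} {w : EuclideanSpace ℝ (Fin d) → ℝ}

lemma abs_traceForm_hess_sub_le (h : IsUnitSolution κ A α r b S w) (hκ : 0 ≤ κ) (hA : 0 ≤ A)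
    (hα0 : 0 < α) (hα1 : α < 1) {x₀ : EuclideanSpace ℝ (Fin d)} {R N : ℝ} (hR : 0 < R)
    (hR1 : R ≤ 1) (hN : ∀ y ∈ closedBall x₀ R, ‖hess w y‖ ≤ N)
    {y : EuclideanSpace ℝ (Fin d)} (hy : y ∈ closedBall x₀ (R / 2)) :
    |traceForm (S x₀) (hess w y) - traceForm (S x₀) (hess w x₀)|
      ≤ (8 * A * (1 + d * A) + 2 * A + 2 * (1 + d * A) + 2 * d * A + d ^ 2 * A)
        * (1 / R + N) * ‖y - x₀‖ ^ α := by
  set G : ℝ := 4 * A / R + N with hG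
  set t : ℝ := ‖y - x₀‖ with ht
  have hx₀R : x₀ ∈ closedBall x₀ (R / 2) := mem_closedBall_self (by positivity)
  have hsub : closedBall x₀ (R / 2) ⊆ closedBall x₀ R := closedBall_subset_closedBall (by linarith)
  have hN0 : 0 ≤ N := (norm_nonneg (hess w x₀)).trans (hN x₀ (hsub hx₀R))
  have hG0 : 0 ≤ G := by positivity
  have ht0 : 0 ≤ t := norm_nonneg _
  have htR : t ≤ R / 2 := mem_closedBall_iff_norm.1 hy
  have ht1 : t ≤ t ^ α := Real.self_le_rpow_of_le_one ht0 (by linarith) hα1.le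
  have hdist : dist y x₀ = t := dist_eq_norm _ _
  have hd1 : dist y x₀ ≤ 1 := by linarith
  have hgrad : ∀ z ∈ closedBall x₀ (R / 2), ‖fderiv ℝ w z‖ ≤ G := by
    intro z hz
    have h1 : closedBall z (R / 2) ⊆ closedBall x₀ R :=
      closedBall_subset_closedBall' (by linarith [mem_closedBall.1 hz])
    refine (norm_fderiv_le_of_hess h.contDiff (half_pos hR) (fun y hy => hN y (h1 hy))
      (h.abs_le_sup hκ hA)).trans ?_
    have e : 2 * A / (R / 2) = 4 * A / R := by field_simp; ring
    rw [e, hG]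
    nlinarith
  have hw : |w y - w x₀| ≤ G * t :=
    (convex_closedBall x₀ (R / 2)).norm_image_sub_le_of_norm_hasFDerivWithin_le
      (fun z _ => (hasFDerivAt_of_contDiff_two h.contDiff z).hasFDerivWithinAt) hgrad hx₀R hy
  have hDw := norm_fderiv_sub_fderiv_le h.contDiff (convex_closedBall x₀ R) hN (hsub hx₀R) (hsub hy)
  have hdrift : |∑ i, b y i * fderiv ℝ w y (EuclideanSpace.single i 1)
      - ∑ i, b x₀ i * fderiv ℝ w x₀ (EuclideanSpace.single i 1)|
      ≤ d * (A * t ^ α * G + A * (N * t)) := by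
    rw [← Finset.sum_sub_distrib]
    refine (Finset.abs_sum_le_sum_abs _ _).trans ?_
    have hi : ∀ i, |b y i * fderiv ℝ w y (EuclideanSpace.single i 1)
        - b x₀ i * fderiv ℝ w x₀ (EuclideanSpace.single i 1)|
        ≤ A * t ^ α * G + A * (N * t) := by
      intro i
      have e : b y i * fderiv ℝ w y (EuclideanSpace.single i 1)
          - b x₀ i * fderiv ℝ w x₀ (EuclideanSpace.single i 1)
          = (b y i - b x₀ i) * fderiv ℝ w y (EuclideanSpace.single i 1)
            + b x₀ i * (fderiv ℝ w y - fderiv ℝ w x₀) (EuclideanSpace.single i 1) := by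
        rw [sub_apply]; ring
      have hn : ‖EuclideanSpace.single i (1 : ℝ)‖ = 1 := by simp
      have h1 := (fderiv ℝ w y).le_opNorm (EuclideanSpace.single i 1)
      have h2 := (fderiv ℝ w y - fderiv ℝ w x₀).le_opNorm (EuclideanSpace.single i 1)
      rw [hn, mul_one, norm_eq_abs] at h1 h2
      rw [e]
      refine (abs_add_le _ _).trans ?_
      rw [abs_mul, abs_mul]
      have h3 := h.drift_holder y x₀ hd1 i
      rw [hdist] at h3
      exact add_le_add (mul_le_mul h3 (h1.trans (hgrad y hy)) (abs_nonneg _) (by positivity))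
        (mul_le_mul (h.abs_drift_le x₀ i) (h2.trans hDw) (abs_nonneg _) hA)
    exact (Finset.sum_le_sum fun i _ => hi i).trans_eq (by simp; ring)
  have hdiff : |traceForm (S y - S x₀) (hess w y)| ≤ d ^ 2 * (A * t ^ α) * N := by
    refine (abs_traceForm_le (a := A * t ^ α) (fun i j => ?_) _).trans ?_
    · have := h.diffusion_holder y x₀ hd1 i j
      rwa [hdist] at this
    · exact mul_le_mul_of_nonneg_left (hN y (hsub hy)) (by positivity)
  have hr := h.source_holder y x₀ hd1
  rw [hdist] at hr
  have e1 := h.eqn y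
  have e2 := h.eqn x₀
  rw [traceForm_sub] at hdiff
  have hmain : |traceForm (S x₀) (hess w y) - traceForm (S x₀) (hess w x₀)|
      ≤ 2 * (G * t) + 2 * (A * t ^ α) + 2 * (d * (A * t ^ α * G + A * (N * t)))
        + d ^ 2 * (A * t ^ α) * N := by
    have i1 := abs_le.1 hw
    have i2 := abs_le.1 hdrift
    have i3 := abs_le.1 hdiff
    have i4 := abs_le.1 hr
    rw [abs_le]
    constructor <;> linarith [i1.1, i1.2, i2.1, i2.2, i3.1, i3.2, i4.1, i4.2]
  have hRinv : 1 ≤ 1 / R := by rwa [le_div_iff₀ hR, one_mul]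
  have ha0 : 0 ≤ t ^ α := Real.rpow_nonneg ht0 _
  have hd0 : (0 : ℝ) ≤ d := Nat.cast_nonneg d
  calc _ ≤ _ := hmain
    _ ≤ 2 * (G * t ^ α) + 2 * (A * t ^ α) + 2 * (d * (A * t ^ α * G + A * (N * t ^ α)))
        + d ^ 2 * (A * t ^ α) * N := by gcongr
    _ = (2 * G * (1 + d * A) + 2 * A + 2 * d * A * N + d ^ 2 * A * N) * t ^ α := by ring
    _ ≤ _ := by
      refine mul_le_mul_of_nonneg_right ?_ ha0
      have e : G = 4 * A * (1 / R) + N := by rw [hG]; ring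
      set q := 1 / R
      have hq0 : 0 ≤ q := by linarith
      have p1 : 0 ≤ (d : ℝ) * A := by positivity
      have p2 : 0 ≤ (d : ℝ) ^ 2 * A := by positivity
      have p3 : 0 ≤ A * N := by positivity
      have p4 : 0 ≤ d * A * q := by positivity
      have p5 : 0 ≤ d ^ 2 * A * q := by positivity
      have p6 : 0 ≤ d * A * (A * N) := by positivity
      have p7 : A ≤ A * q := le_mul_of_one_le_right hA hRinv
      rw [e]
      nlinarith

end IsUnitSolution

lemma exists_oscBound_of_isUnitSolution (d : ℕ) {κ A α : ℝ} (hκ : 0 < κ) (hA : 0 ≤ A)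
    (hα0 : 0 < α) (hα1 : α < 1) :
    ∃ C : ℝ, 0 < C ∧ ∀ (r : EuclideanSpace ℝ (Fin d) → ℝ)
      (b : EuclideanSpace ℝ (Fin d) → Fin d → ℝ)
      (S : EuclideanSpace ℝ (Fin d) → Matrix (Fin d) (Fin d) ℝ)
      (w : EuclideanSpace ℝ (Fin d) → ℝ), IsUnitSolution κ A α r b S w →
      ∀ (x₀ : EuclideanSpace ℝ (Fin d)) (R N t : ℝ), R ≤ 1 → 0 < t → t ≤ R / 8 →
        (∀ y ∈ closedBall x₀ R, ‖hess w y‖ ≤ N) →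
        ∀ s, 0 < s → s ≤ t →
          OscBound w x₀ s s s (C * (1 / t ^ (2 + α) + (1 / R + N)) * s ^ (2 + α)) := by
  obtain ⟨C, hC, hdecay⟩ := exists_oscBound_decay (E := EuclideanSpace ℝ (Fin d)) (κ := κ)
    (τ := d * A) hκ (by positivity) hα0 hα1
  set K : ℝ := 8 * A * (1 + d * A) + 2 * A + 2 * (1 + d * A) + 2 * d * A + d ^ 2 * A with hK
  have hK0 : 0 < K := by positivity
  refine ⟨C * (A + K), by positivity, fun r b S w h x₀ R N t hR1 ht htR hN s hs hst => ?_⟩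
  have hR : 0 < R := by linarith
  have hN0 : 0 ≤ N := (norm_nonneg (hess w x₀)).trans (hN x₀ (mem_closedBall_self hR.le))
  have hsub : closedBall x₀ (4 * t) ⊆ closedBall x₀ (R / 2) :=
    closedBall_subset_closedBall (by linarith)
  refine (hdecay (traceForm (S x₀))
    (isEllipticForm_traceForm hκ.le (h.isSymm x₀) (h.elliptic x₀) (h.abs_diffusion_le x₀))
    w h.contDiff x₀ t _ (K * (1 / R + N)) A ht (by positivity)
    (fun y hy => h.abs_traceForm_hess_sub_le hκ.le hA hα0 hα1 hR hR1 hN (hsub hy))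
    (fun y _ => h.abs_le_sup hκ.le hA y) s hs hst).mono le_rfl le_rfl le_rfl ?_
  have hs' : 0 ≤ s ^ (2 + α) := by positivity
  have ht' : 0 ≤ 1 / t ^ (2 + α) := by positivity
  have hq : 0 ≤ 1 / R + N := by positivity
  refine mul_le_mul_of_nonneg_right ?_ hs'
  rw [mul_assoc]
  refine mul_le_mul_of_nonneg_left ?_ hC.le
  rw [div_eq_mul_one_div A]
  nlinarith [mul_nonneg hA hq, mul_nonneg hK0.le ht']

end InteriorHessian

section UnitEstimates

lemma norm_sub_le_mul_rpow_of_lipschitz {E F : Type*} [NormedAddCommGroup E]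
    [NormedAddCommGroup F] {f : E → F} {C α : ℝ} (hα0 : 0 < α) (hα1 : α < 1)
    (hsup : ∀ x, ‖f x‖ ≤ C) (hlip : ∀ x y, ‖f x - f y‖ ≤ C * ‖x - y‖) (x y : E) :
    ‖f x - f y‖ ≤ 2 * C * ‖x - y‖ ^ α := by
  have hC : 0 ≤ C := (norm_nonneg _).trans (hsup x)
  rcases le_total ‖x - y‖ 1 with h | h
  · have h1 := Real.self_le_rpow_of_le_one (norm_nonneg _) h hα1.le
    have h2 := mul_le_mul_of_nonneg_left h1 hC
    have h3 := mul_nonneg hC ((norm_nonneg _).trans h1)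
    linarith [hlip x y]
  · have h1 := Real.one_le_rpow h hα0.le
    have h2 := norm_sub_le (f x) (f y)
    nlinarith [hsup x, hsup y]

lemma continuous_norm_hess {E : Type*} [NormedAddCommGroup E] [NormedSpace ℝ E] {u : E → ℝ}
    (hu : ContDiff ℝ 2 u) : Continuous fun x => ‖hess u x‖ :=
  (continuous_norm (E := E →L[ℝ] E →L[ℝ] ℝ)).comp (continuous_hess hu)

lemma exists_norm_hess_le_of_isUnitSolution (d : ℕ) {κ A α : ℝ} (hκ : 0 < κ) (hA : 0 ≤ A)
    (hα0 : 0 < α) (hα1 : α < 1) :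
    ∃ N : ℝ, 0 < N ∧ ∀ (r : EuclideanSpace ℝ (Fin d) → ℝ)
      (b : EuclideanSpace ℝ (Fin d) → Fin d → ℝ)
      (S : EuclideanSpace ℝ (Fin d) → Matrix (Fin d) (Fin d) ℝ)
      (w : EuclideanSpace ℝ (Fin d) → ℝ), IsUnitSolution κ A α r b S w →
      ∀ z, ‖hess w z‖ ≤ N := by
  obtain ⟨C, hC, hosc⟩ := exists_oscBound_of_isUnitSolution d hκ hA hα0 hα1
  have h2α : (2⁻¹ : ℝ) ^ α < 1 := Real.rpow_lt_one (by norm_num) (by norm_num) hα0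
  set H : ℝ := 3 / (1 - 2⁻¹ ^ α) with hH
  have hH0 : 0 < H := div_pos (by norm_num) (by linarith)
  have hHC : 0 < H * C := mul_pos hH0 hC
  set θ : ℝ := min (1 / 8) ((1 / (8 * (H * C))) ^ α⁻¹) with hθ
  have hθ0 : 0 < θ := lt_min (by norm_num) (by positivity)
  have hθ8 : θ ≤ 1 / 8 := min_le_left _ _
  have hθα : H * C * θ ^ α ≤ 1 / 8 := by
    have h1 : θ ^ α ≤ 1 / (8 * (H * C)) := by
      refine (Real.rpow_le_rpow hθ0.le (min_le_right _ _) hα0.le).trans_eq ?_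
      exact Real.rpow_inv_rpow (by positivity) hα0.ne'
    rw [le_div_iff₀ (by positivity)] at h1
    linarith
  refine ⟨8 * (4 * A + H * C) / θ ^ 2 + 1, by positivity, fun r b S w h z => ?_⟩
  have hcont : Continuous fun x => (1 - ‖x - z‖) ^ 2 * ‖hess w x‖ := by
    have h1 := continuous_norm_hess h.contDiff
    fun_prop
  obtain ⟨x₀, hx₀, hmax⟩ := (isCompact_closedBall z 1).exists_isMaxOn
    ⟨z, mem_closedBall_self zero_le_one⟩ hcont.continuousOn
  set N : ℝ := (1 - ‖x₀ - z‖) ^ 2 * ‖hess w x₀‖ with hN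
  have hmax' : ∀ x ∈ closedBall z 1, (1 - ‖x - z‖) ^ 2 * ‖hess w x‖ ≤ N := fun x hx => hmax hx
  have hz := hmax' z (mem_closedBall_self zero_le_one)
  simp only [sub_self, norm_zero, sub_zero, one_pow, one_mul] at hz
  refine hz.trans ?_
  set δ : ℝ := 1 - ‖x₀ - z‖ with hδ
  have hδ1 : δ ≤ 1 := by linarith [norm_nonneg (x₀ - z)]
  have hδ0 : 0 ≤ δ := by linarith [mem_closedBall_iff_norm.1 hx₀]
  rcases hδ0.eq_or_lt with h0 | hδp
  · have : N = 0 := by rw [hN, ← h0]; ring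
    rw [this]
    positivity
  have hN0 : 0 ≤ N := by positivity
  have hball : ∀ y ∈ closedBall x₀ (δ / 2), ‖hess w y‖ ≤ 4 * N / δ ^ 2 := by
    intro y hy
    have h1 : ‖y - z‖ ≤ 1 - δ / 2 := by
      have := norm_sub_le_norm_sub_add_norm_sub y x₀ z
      linarith [mem_closedBall_iff_norm.1 hy]
    have h2 := hmax' y (mem_closedBall_iff_norm.2 (by linarith))
    rw [le_div_iff₀ (by positivity)]
    have h3 : (δ / 2) ^ 2 ≤ (1 - ‖y - z‖) ^ 2 := by gcongr; linarith
    nlinarith [mul_le_mul_of_nonneg_right h3 (norm_nonneg (hess w y))]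
  set t : ℝ := θ * δ / 2 with ht
  have ht0 : 0 < t := by positivity
  have hb := norm_hess_le_of_oscBound h.contDiff hα0 ht0 (by positivity)
    (hosc r b S w h x₀ (δ / 2) (4 * N / δ ^ 2) t (by linarith) ht0 (by rw [ht]; nlinarith) hball)
    (h.abs_le_sup hκ.le hA)
  rw [← hH] at hb
  have e1 : H * (C * (1 / t ^ (2 + α) + (1 / (δ / 2) + 4 * N / δ ^ 2))) * t ^ α
      = H * C / t ^ 2 + H * C * t ^ α * (2 / δ + 4 * N / δ ^ 2) := by
    rw [Real.rpow_add ht0, Real.rpow_two]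
    have : t ^ α ≠ 0 := (Real.rpow_pos_of_pos ht0 α).ne'
    field_simp
  have htα : H * C * t ^ α ≤ 1 / 8 := by
    refine le_trans ?_ hθα
    have : t ≤ θ := by rw [ht]; nlinarith
    gcongr
  have hq : 0 ≤ 2 / δ + 4 * N / δ ^ 2 := by positivity
  have h5 : ‖hess w x₀‖ ≤ (4 * A + H * C) / t ^ 2 + 1 / 8 * (2 / δ + 4 * N / δ ^ 2) := by
    rw [e1] at hb
    refine hb.trans ?_
    rw [add_div]
    linarith [mul_le_mul_of_nonneg_right htα hq]
  have h6 : N ≤ 4 * (4 * A + H * C) / θ ^ 2 + 1 / 4 * δ + 1 / 2 * N := by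
    calc N ≤ δ ^ 2 * ((4 * A + H * C) / t ^ 2 + 1 / 8 * (2 / δ + 4 * N / δ ^ 2)) := by
          rw [hN]; gcongr
      _ = _ := by rw [ht]; field_simp; ring
  have e2 : 8 * (4 * A + H * C) / θ ^ 2 = 2 * (4 * (4 * A + H * C) / θ ^ 2) := by ring
  linarith

lemma exists_holder_bound_of_isUnitSolution (d : ℕ) {κ A α : ℝ} (hκ : 0 < κ) (hA : 0 ≤ A)
    (hα0 : 0 < α) (hα1 : α < 1) :
    ∃ C : ℝ, ∀ (r : EuclideanSpace ℝ (Fin d) → ℝ)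
      (b : EuclideanSpace ℝ (Fin d) → Fin d → ℝ)
      (S : EuclideanSpace ℝ (Fin d) → Matrix (Fin d) (Fin d) ℝ)
      (w : EuclideanSpace ℝ (Fin d) → ℝ), IsUnitSolution κ A α r b S w →
      (∀ x, |w x| ≤ C) ∧ (∀ x, ‖fderiv ℝ w x‖ ≤ C) ∧ (∀ x, ‖hess w x‖ ≤ C) ∧
      (∀ x y, |w x - w y| ≤ C * ‖x - y‖ ^ α) ∧
      (∀ x y, ‖fderiv ℝ w x - fderiv ℝ w y‖ ≤ C * ‖x - y‖ ^ α) ∧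
      (∀ x y, ‖hess w x - hess w y‖ ≤ C * ‖x - y‖ ^ α) := by
  obtain ⟨N, hN, hhess⟩ := exists_norm_hess_le_of_isUnitSolution d hκ hA hα0 hα1
  obtain ⟨C, hC, hosc⟩ := exists_oscBound_of_isUnitSolution d hκ hA hα0 hα1
  set B : ℝ := C * (1 / (1 / 8) ^ (2 + α) + (1 / 1 + N)) with hB
  have hB0 : 0 < B := by positivity
  have h2α : (2⁻¹ : ℝ) ^ α < 1 := Real.rpow_lt_one (by norm_num) (by norm_num) hα0
  have hc0 : 0 < 3 / (1 - (2⁻¹ : ℝ) ^ α) := div_pos (by norm_num) (by linarith)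
  set H : ℝ := (2 * (3 / (1 - 2⁻¹ ^ α)) + 1) * B with hH
  have hH0 : 0 < H := by positivity
  set L : ℝ := 2 * A + N with hL
  have hL0 : 0 < L := by positivity
  refine ⟨2 * L + H + 16 * N, fun r b S w h => ?_⟩
  have hw := h.abs_le_sup hκ.le hA
  have hD : ∀ x, ‖fderiv ℝ w x‖ ≤ L := fun x => by
    simpa using norm_fderiv_le_of_hess h.contDiff one_pos (fun y _ => hhess r b S w h y) hw
  have hwL : ∀ x, ‖w x‖ ≤ L := fun x => by rw [norm_eq_abs]; linarith [hw x]
  have hexp : ∀ {c : ℝ} (x y : EuclideanSpace ℝ (Fin d)), c ≤ 2 * L + H + 16 * N →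
      c * ‖x - y‖ ^ α ≤ (2 * L + H + 16 * N) * ‖x - y‖ ^ α := fun x y hc =>
    mul_le_mul_of_nonneg_right hc (Real.rpow_nonneg (norm_nonneg _) _)
  refine ⟨fun x => (hw x).trans (by linarith), fun x => (hD x).trans (by linarith),
    fun x => (hhess r b S w h x).trans (by linarith), fun x y => ?_, fun x y => ?_, fun x y => ?_⟩
  · refine (norm_sub_le_mul_rpow_of_lipschitz hα0 hα1 hwL (fun x y => ?_) x y).trans (hexp (c := 2 * L) x y (by linarith))
    exact convex_univ.norm_image_sub_le_of_norm_hasFDerivWithin_le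
      (fun z _ => (hasFDerivAt_of_contDiff_two h.contDiff z).hasFDerivWithinAt) (fun z _ => hD z)
      (Set.mem_univ y) (Set.mem_univ x)
  · refine (norm_sub_le_mul_rpow_of_lipschitz hα0 hα1 hD (fun x y => ?_) x y).trans
      (hexp (c := 2 * L) x y (by linarith))
    exact norm_fderiv_sub_fderiv_le h.contDiff convex_univ
      (fun z _ => (hhess r b S w h z).trans (by linarith)) (Set.mem_univ y) (Set.mem_univ x)
  · rcases le_total ‖x - y‖ (1 / 8) with hxy | hxy
    · refine (norm_hess_sub_hess_le h.contDiff hα0 hB0.le (fun x s hs hst => ?_) hxy).trans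
        (hexp x y (by linarith))
      exact hosc r b S w h x 1 N (1 / 8) le_rfl (by norm_num) le_rfl
        (fun y _ => hhess r b S w h y) s hs hst
    · refine le_trans ?_ (hexp (c := 16 * N) x y (by linarith))
      have h1 : (1 / 8 : ℝ) ≤ ‖x - y‖ ^ α :=
        (Real.self_le_rpow_of_le_one (by norm_num) (by norm_num) hα1.le).trans
          (Real.rpow_le_rpow (by norm_num) hxy hα0.le)
      have h2 : ‖hess w x - hess w y‖ ≤ N + N :=
        (norm_sub_le (hess w x) (hess w y)).trans (add_le_add (hhess r b S w h x) (hhess r b S w h y))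
      nlinarith

end UnitEstimates

section Rescaling

section IteratedDerivative

variable {E : Type*} [NormedAddCommGroup E] [NormedSpace ℝ E]

lemma norm_iteratedFDeriv_two_le (u : E → ℝ) (x : E) :
    ‖iteratedFDeriv ℝ 2 u x‖ ≤ ‖hess u x‖ := by
  refine ContinuousMultilinearMap.opNorm_le_bound (norm_nonneg (hess u x)) fun m => ?_
  rw [iteratedFDeriv_two_apply, Fin.prod_univ_two, ← mul_assoc]
  exact (hess u x).le_opNorm₂ (m 0) (m 1)

lemma norm_iteratedFDeriv_two_sub_le (u : E → ℝ) (x y : E) :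
    ‖iteratedFDeriv ℝ 2 u x - iteratedFDeriv ℝ 2 u y‖ ≤ ‖hess u x - hess u y‖ := by
  refine ContinuousMultilinearMap.opNorm_le_bound (norm_nonneg (hess u x - hess u y)) fun m => ?_
  rw [sub_apply, iteratedFDeriv_two_apply, iteratedFDeriv_two_apply,
    Fin.prod_univ_two, ← mul_assoc]
  exact (hess u x - hess u y).le_opNorm₂ (m 0) (m 1)

lemma fderiv_const_mul_comp_smul (v : E → ℝ) (a c : ℝ) (y : E) :
    fderiv ℝ (fun y => a * v (c • y)) y = (a * c) • fderiv ℝ v (c • y) := by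
  have h := fderiv_const_smul_field (𝕜 := ℝ) (f := fun y => v (c • y)) a
  replace h := congrFun h y
  rw [Pi.smul_apply, fderiv_comp_smul, smul_smul] at h
  exact h

lemma hess_const_mul_comp_smul (v : E → ℝ) (a c : ℝ) (y : E) :
    hess (fun y => a * v (c • y)) y = (a * c * c) • hess v (c • y) := by
  have h := fderiv_const_smul_field (𝕜 := ℝ) (f := fun y => fderiv ℝ v (c • y)) (a * c)
  replace h := congrFun h y
  rw [Pi.smul_apply, fderiv_comp_smul, smul_smul] at h
  rw [hess, funext (fderiv_const_mul_comp_smul v a c)]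
  exact h

end IteratedDerivative

variable {d : ℕ}

lemma pd2_eq_hess {v : EuclideanSpace ℝ (Fin d) → ℝ} (hv : ContDiff ℝ 2 v)
    (x : EuclideanSpace ℝ (Fin d)) (i j : Fin d) :
    pd2 d v x i j = hess v x (EuclideanSpace.single i 1) (EuclideanSpace.single j 1) := by
  have h := (hasFDerivAt_fderiv hv x).clm_apply (hasFDerivAt_const (EuclideanSpace.single j 1) x)
  rw [pd2, h.fderiv]
  simp

/-- If `v` solves the equation with discount rate `p ^ 2`, then `y ↦ p ^ 2 * v (y / p)` solves
the equation with discount rate one. -/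
lemma isUnitSolution_rescale {κ A α p : ℝ} (hα0 : 0 < α) (hp : 1 ≤ p)
    {r : EuclideanSpace ℝ (Fin d) → ℝ} {b : EuclideanSpace ℝ (Fin d) → Fin d → ℝ}
    {S : EuclideanSpace ℝ (Fin d) → Matrix (Fin d) (Fin d) ℝ}
    {v : EuclideanSpace ℝ (Fin d) → ℝ}
    (hS : ∀ x, (S x).IsSymm)
    (hell : ∀ x (ξ : Fin d → ℝ), κ * ∑ i, ξ i ^ 2 ≤ ∑ i, ∑ j, ξ i * S x i j * ξ j)
    (hr : ∀ x, |r x| ≤ A)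
    (hrα : ∀ x y, dist x y ≤ 1 → |r x - r y| ≤ A * dist x y ^ α)
    (hb : ∀ x i, |b x i| ≤ A)
    (hbα : ∀ x y, dist x y ≤ 1 → ∀ i, |b x i - b y i| ≤ A * dist x y ^ α)
    (hSA : ∀ x i j, |S x i j| ≤ A)
    (hSα : ∀ x y, dist x y ≤ 1 → ∀ i j, |S x i j - S y i j| ≤ A * dist x y ^ α)
    (hv : ContDiff ℝ 2 v) (hbdd : ∃ M, ∀ x, |v x| ≤ M)
    (heq : ∀ x, p ^ 2 * v x - r x - (∑ i, b x i * pd1 d v x i)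
      - (1 / 2) * ∑ i, ∑ j, S x i j * pd2 d v x j i = 0) :
    IsUnitSolution κ A α (fun y => r (p⁻¹ • y)) (fun y i => p⁻¹ * b (p⁻¹ • y) i)
      (fun y => S (p⁻¹ • y)) (fun y => p ^ 2 * v (p⁻¹ • y)) := by
  have hp0 : 0 < p := by linarith
  have hq0 : 0 < p⁻¹ := inv_pos.2 hp0
  have hq1 : p⁻¹ ≤ 1 := inv_le_one_of_one_le₀ hp
  have hA : 0 ≤ A := (abs_nonneg _).trans (hr 0)
  have hdist : ∀ x y : EuclideanSpace ℝ (Fin d), dist (p⁻¹ • x) (p⁻¹ • y) ≤ dist x y := by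
    intro x y
    rw [dist_smul₀, norm_of_nonneg hq0.le]
    exact mul_le_of_le_one_left dist_nonneg hq1
  have hpow : ∀ x y : EuclideanSpace ℝ (Fin d),
      A * dist (p⁻¹ • x) (p⁻¹ • y) ^ α ≤ A * dist x y ^ α := fun x y =>
    mul_le_mul_of_nonneg_left (Real.rpow_le_rpow dist_nonneg (hdist x y) hα0.le) hA
  refine ⟨fun x => hS _, fun x => hell _, fun x => hr _,
    fun x y h => (hrα _ _ ((hdist x y).trans h)).trans (hpow x y), fun x i => ?_,
    fun x y h i => ?_, fun x => hSA _,
    fun x y h i j => (hSα _ _ ((hdist x y).trans h) i j).trans (hpow x y), ?_, ?_, fun x => ?_⟩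
  · rw [abs_mul, abs_of_pos hq0]
    exact (mul_le_of_le_one_left (abs_nonneg _) hq1).trans (hb _ i)
  · rw [← mul_sub, abs_mul, abs_of_pos hq0]
    exact (mul_le_of_le_one_left (abs_nonneg _) hq1).trans
      ((hbα _ _ ((hdist x y).trans h) i).trans (hpow x y))
  · fun_prop
  · obtain ⟨M, hM⟩ := hbdd
    refine ⟨p ^ 2 * M, fun x => ?_⟩
    rw [abs_mul, abs_of_nonneg (sq_nonneg p)]
    exact mul_le_mul_of_nonneg_left (hM _) (sq_nonneg p)
  · have h := heq (p⁻¹ • x)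
    have e1 : p ^ 2 * p⁻¹ * p⁻¹ = 1 := by field_simp
    have e2 : ∑ i, p⁻¹ * b (p⁻¹ • x) i
        * fderiv ℝ (fun y => p ^ 2 * v (p⁻¹ • y)) x (EuclideanSpace.single i 1)
        = ∑ i, b (p⁻¹ • x) i * pd1 d v (p⁻¹ • x) i := by
      refine Finset.sum_congr rfl fun i _ => ?_
      rw [fderiv_const_mul_comp_smul, smul_apply, smul_eq_mul, pd1]
      linear_combination (b (p⁻¹ • x) i
        * fderiv ℝ v (p⁻¹ • x) (EuclideanSpace.single i 1)) * e1
    rw [e2, hess_const_mul_comp_smul, e1, one_smul, traceForm_apply]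
    simp only [pd2_eq_hess hv] at h
    linarith

end Rescaling

/-- Lemma 2.1: uniform estimates, with explicit dependence on the (large) discount rate `ρ`,
for bounded classical solutions of the linear elliptic equation
`ρ v - r̃ - b̃ · Dv - (1/2) tr(Σ̃ D²v) = 0` with coefficients bounded in `C^{0,α}` by `A` and
uniformly elliptic diffusion `Σ̃ ≥ I/C₀`. -/
theorem stmt0 (d : ℕ) (C₀ α : ℝ) (hC₀ : 0 < C₀) (hα0 : 0 < α) (hα1 : α < 1) :
    ∃ η : ℝ → ℝ, MonotoneOn η (Set.Ici 1) ∧ (∀ A, 1 ≤ A → 1 ≤ η A) ∧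
      ∀ (ρ A : ℝ), 1 ≤ ρ → 1 ≤ A →
      ∀ (rr : EuclideanSpace ℝ (Fin d) → ℝ)
        (bb : EuclideanSpace ℝ (Fin d) → Fin d → ℝ)
        (S : EuclideanSpace ℝ (Fin d) → Matrix (Fin d) (Fin d) ℝ)
        (v : EuclideanSpace ℝ (Fin d) → ℝ),
        (∀ x, (S x).IsSymm) →
        -- uniform ellipticity: Σ̃ ≥ I_d / C₀
        (∀ x (ξ : Fin d → ℝ), (1 / C₀) * ∑ i, ξ i ^ 2 ≤ ∑ i, ∑ j, ξ i * S x i j * ξ j) →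
        -- ‖r̃‖_{0,α} ≤ A
        (∀ x, |rr x| ≤ A) →
        (∀ x y, dist x y ≤ 1 → |rr x - rr y| ≤ A * dist x y ^ α) →
        -- ‖b̃‖_{0,α} ≤ A (entrywise)
        (∀ x i, |bb x i| ≤ A) →
        (∀ x y, dist x y ≤ 1 → ∀ i, |bb x i - bb y i| ≤ A * dist x y ^ α) →
        -- ‖Σ̃‖_{0,α} ≤ A (entrywise)
        (∀ x i j, |S x i j| ≤ A) →
        (∀ x y, dist x y ≤ 1 → ∀ i j, |S x i j - S y i j| ≤ A * dist x y ^ α) →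
        -- v is a bounded classical (C²) solution
        ContDiff ℝ 2 v →
        (∃ M, ∀ x, |v x| ≤ M) →
        (∀ x, ρ * v x - rr x - (∑ i, bb x i * pd1 d v x i)
            - (1/2) * ∑ i, ∑ j, S x i j * pd2 d v x j i = 0) →
        -- conclusions: ρ‖v‖_∞, ρ^{1-α/2}[v]_{0,α}, ρ^{1/2-α/2}[v]_{1,α},
        -- ρ^{-α/2}[v]_{2,α}, ρ^{1/2}⟦v⟧₁, ⟦v⟧₂ ≤ η(A)
        (∀ x, ρ * |v x| ≤ η A) ∧
        (∀ x y, dist x y ≤ 1 → ρ ^ (1 - α/2) * |v x - v y| ≤ η A * dist x y ^ α) ∧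
        (∀ x y, dist x y ≤ 1 →
          ρ ^ (1/2 - α/2) * ‖fderiv ℝ v x - fderiv ℝ v y‖ ≤ η A * dist x y ^ α) ∧
        (∀ x y, dist x y ≤ 1 →
          ρ ^ (-α/2) * ‖iteratedFDeriv ℝ 2 v x - iteratedFDeriv ℝ 2 v y‖
            ≤ η A * dist x y ^ α) ∧
        (∀ x, ρ ^ ((1:ℝ)/2) * ‖fderiv ℝ v x‖ ≤ η A) ∧
        (∀ x, ‖iteratedFDeriv ℝ 2 v x‖ ≤ η A) := by
  have hκ : 0 < 1 / C₀ := by positivity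
  choose C hC using fun n : ℕ =>
    exists_holder_bound_of_isUnitSolution d hκ (Nat.cast_nonneg (α := ℝ) n) hα0 hα1
  refine ⟨fun A => 1 + ∑ n ∈ Finset.range (⌈A⌉₊ + 1), |C n|, fun A _ B _ hAB => ?_, fun A _ => ?_,
    fun ρ A hρ _ r b S v hS hell hr hrα hb hbα hSA hSα hv hbdd heq => ?_⟩
  · refine add_le_add_right (Finset.sum_le_sum_of_subset_of_nonneg ?_ fun _ _ _ => abs_nonneg _) 1
    exact Finset.range_mono (Nat.succ_le_succ (Nat.ceil_mono hAB))
  · exact le_add_of_nonneg_right (Finset.sum_nonneg fun _ _ => abs_nonneg _)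
  have hη : C ⌈A⌉₊ ≤ 1 + ∑ n ∈ Finset.range (⌈A⌉₊ + 1), |C n| := by
    have := Finset.single_le_sum (f := fun n => |C n|) (fun _ _ => abs_nonneg _)
      (Finset.self_mem_range_succ ⌈A⌉₊)
    linarith [le_abs_self (C ⌈A⌉₊)]
  set η : ℝ := 1 + ∑ n ∈ Finset.range (⌈A⌉₊ + 1), |C n|
  have hAn : A ≤ ⌈A⌉₊ := Nat.le_ceil A
  have hAα : ∀ x y : EuclideanSpace ℝ (Fin d), A * dist x y ^ α ≤ ⌈A⌉₊ * dist x y ^ α :=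
    fun x y => mul_le_mul_of_nonneg_right hAn (Real.rpow_nonneg dist_nonneg _)
  have hρ0 : 0 < ρ := by linarith
  obtain ⟨p, hp, hpρ⟩ : ∃ p : ℝ, 1 ≤ p ∧ ρ = p ^ 2 :=
    ⟨√ρ, Real.one_le_sqrt.2 hρ, (Real.sq_sqrt hρ0.le).symm⟩
  have hp0 : 0 < p := by linarith
  rw [hpρ] at heq
  obtain ⟨h0, h1, h2, hα0', hα1', hα2'⟩ := hC ⌈A⌉₊ _ _ _ _
    (isUnitSolution_rescale hα0 hp hS hell (fun x => (hr x).trans hAn)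
      (fun x y h => (hrα x y h).trans (hAα x y)) (fun x i => (hb x i).trans hAn)
      (fun x y h i => (hbα x y h i).trans (hAα x y)) (fun x i j => (hSA x i j).trans hAn)
      (fun x y h i j => (hSα x y h i j).trans (hAα x y)) hv hbdd heq)
  have hpp : ∀ x : EuclideanSpace ℝ (Fin d), p⁻¹ • p • x = x := fun x => inv_smul_smul₀ hp0.ne' x
  have ep : p ^ 2 * p⁻¹ = p := by field_simp
  have ep1 : p ^ 2 * p⁻¹ * p⁻¹ = 1 := by field_simp
  set P : ℝ := p ^ α with hP
  have hP0 : 0 < P := Real.rpow_pos_of_pos hp0 α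
  have hsub : ∀ x y : EuclideanSpace ℝ (Fin d), ‖p • x - p • y‖ ^ α = P * dist x y ^ α := by
    intro x y
    rw [← smul_sub, norm_smul, norm_of_nonneg hp0.le, Real.mul_rpow hp0.le (norm_nonneg _),
      dist_eq_norm]
  have hρpow : ∀ s : ℝ, ρ ^ s = p ^ (2 * s) := by
    intro s
    rw [hpρ, ← Real.rpow_two, ← Real.rpow_mul hp0.le]
  have key : ∀ {s k z : ℝ} {x y : EuclideanSpace ℝ (Fin d)}, 2 * s + α = k →
      p ^ k * z ≤ C ⌈A⌉₊ * (P * dist x y ^ α) → ρ ^ s * z ≤ η * dist x y ^ α := by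
    intro s k z x y hk hz
    rw [← hk, Real.rpow_add hp0, ← hρpow, ← hP] at hz
    have h3 : ρ ^ s * z ≤ C ⌈A⌉₊ * dist x y ^ α := le_of_mul_le_mul_right (by linarith) hP0
    exact h3.trans (mul_le_mul_of_nonneg_right hη (Real.rpow_nonneg dist_nonneg _))
  refine ⟨fun x => ?_, fun x y _ => ?_, fun x y _ => ?_, fun x y _ => ?_, fun x => ?_, fun x => ?_⟩
  · have := h0 (p • x)
    rw [hpp, abs_mul, ← hpρ, abs_of_pos hρ0] at this
    exact this.trans hη
  · have := hα0' (p • x) (p • y)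
    rw [hpp, hpp, ← mul_sub, abs_mul, abs_of_nonneg (sq_nonneg p), hsub] at this
    refine key (k := 2) (by ring) ?_
    rwa [Real.rpow_two]
  · have := hα1' (p • x) (p • y)
    rw [fderiv_const_mul_comp_smul, fderiv_const_mul_comp_smul, hpp, hpp, ← smul_sub, norm_smul, ep, norm_of_nonneg hp0.le,
      hsub] at this
    refine key (k := 1) (by ring) ?_
    rwa [Real.rpow_one]
  · have := hα2' (p • x) (p • y)
    rw [hess_const_mul_comp_smul, hess_const_mul_comp_smul, hpp, hpp, ep1, one_smul, one_smul,
      hsub] at this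
    refine key (k := 0) (by ring) ?_
    rw [Real.rpow_zero, one_mul]
    exact (norm_iteratedFDeriv_two_sub_le v x y).trans this
  · have := h1 (p • x)
    rw [fderiv_const_mul_comp_smul, hpp, norm_smul, ep, norm_of_nonneg hp0.le] at this
    rw [hρpow, mul_one_div_cancel two_ne_zero, Real.rpow_one]
    exact this.trans hη
  · have := h2 (p • x)
    rw [hess_const_mul_comp_smul, hpp, ep1, one_smul] at this
    exact ((norm_iteratedFDeriv_two_le v x).trans this).trans hη
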